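/- There exists a universal constant C > 0 with the following property. Let k₁, k₂ ∈ ℤ with k₂ ≥ k₁ + 80, let m ∈ {1,2}, and let u, v : ℝ × ℝ² → ℂ be smooth functions such that for every t the functions u(t,·) and v(t,·) are Schwartz on ℝ², the spatial Fourier transform of u(t,·) is supported in { ξ ∈ ℝ² : 2^{k₁−1} ≤ |ξ| ≤ 2^{k₁+1} }, and the spatial Fourier transform of v(t,·) is supported in { ξ ∈ ℝ² : 2^{k₂−1} ≤ |ξ| ≤ 2^{k₂+1} and |ξ| ≤ 4 |ξ_m| }. Set N := (i∂_t + ∂₁² − ∂₂²)u and N' := (i∂_t + ∂₁² − ∂₂²)v. Then sup_{y ∈ ℝ²} B_m(u^y, v) ≤ C · 2^{−k₂/2} · ( ‖u‖_{L^∞_t L²_x} + I(u,N)^{1/2} ) · ( ‖v‖_{L^∞_t L²_x} + I(v,N')^{1/2} ), provided the right-hand side is finite. -/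

import Mathlib

open MeasureTheory ENNReal NNReal

noncomputable section

/-- Fourier transform in the two spatial variables on `ℝ²`. -/
def spatialFourier (f : ℝ × ℝ → ℂ) (ξ : ℝ × ℝ) : ℂ :=
  ∫ x : ℝ × ℝ, Complex.exp (-(2 * Real.pi * (x.1 * ξ.1 + x.2 * ξ.2)) * Complex.I) * f x

/-- Euclidean length of `ξ ∈ ℝ²`. -/
def elen (ξ : ℝ × ℝ) : ℝ := Real.sqrt (ξ.1 ^ 2 + ξ.2 ^ 2)

/-- The `L^∞_t L²_x` norm, valued in `ℝ≥0∞`. -/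
def LinfL2 (u : ℝ × ℝ × ℝ → ℂ) : ℝ≥0∞ :=
  ⨆ t : ℝ, (∫⁻ x : ℝ × ℝ, (‖u (t, x.1, x.2)‖₊ : ℝ≥0∞) ^ 2) ^ (1 / 2 : ℝ)

/-- The interaction functional `I(u,N) = sup_y ∫∫ |u^y| |N|`, valued in `ℝ≥0∞`. -/
def interact (u N : ℝ × ℝ × ℝ → ℂ) : ℝ≥0∞ :=
  ⨆ y : ℝ × ℝ, ∫⁻ p : ℝ × ℝ × ℝ,
    (‖u (p.1, p.2.1 - y.1, p.2.2 - y.2)‖₊ : ℝ≥0∞) * (‖N p‖₊ : ℝ≥0∞)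

/-- The bilinear mixed norm `B_m(u,v)` : `L²` in `x̂_m` inside, `L²` in `(t, x_m)` outside. -/
def Bnorm (m : Fin 2) (u v : ℝ × ℝ × ℝ → ℂ) : ℝ≥0∞ :=
  if m = 0 then
    (∫⁻ t : ℝ, ∫⁻ x1 : ℝ,
        (∫⁻ x2 : ℝ, (‖u (t, x1, x2)‖₊ : ℝ≥0∞) ^ 2) *
          (∫⁻ x2 : ℝ, (‖v (t, x1, x2)‖₊ : ℝ≥0∞) ^ 2)) ^ (1 / 2 : ℝ)
  else
    (∫⁻ t : ℝ, ∫⁻ x2 : ℝ,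
        (∫⁻ x1 : ℝ, (‖u (t, x1, x2)‖₊ : ℝ≥0∞) ^ 2) *
          (∫⁻ x1 : ℝ, (‖v (t, x1, x2)‖₊ : ℝ≥0∞) ^ 2)) ^ (1 / 2 : ℝ)

/-- The hyperbolic Schrödinger operator `i∂_t + ∂₁² − ∂₂²`. -/
def hypSchrod (u : ℝ × ℝ × ℝ → ℂ) (p : ℝ × ℝ × ℝ) : ℂ :=
  Complex.I * fderiv ℝ u p (1, 0, 0)
    + fderiv ℝ (fun q => fderiv ℝ u q (0, 1, 0)) p (0, 1, 0)
    - fderiv ℝ (fun q => fderiv ℝ u q (0, 0, 1)) p (0, 0, 1)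

section
open FourierTransform SchwartzMap
open scoped ContDiff

/-- The Fourier transform of the derivative of a Schwartz function on the line. -/
lemma fourier_derivCLM_apply (h : 𝓢(ℝ, ℂ)) (ξ : ℝ) :
    𝓕 (derivCLM ℂ ℂ h) ξ = (2 * Real.pi * Complex.I * ξ) * 𝓕 h ξ := by
  have h1 : (derivCLM ℂ ℂ h : ℝ → ℂ) = deriv h := by
    ext x; exact derivCLM_apply ℂ h x
  have h2 : Integrable (deriv h) := by
    rw [← h1]; exact (derivCLM ℂ ℂ h).integrable
  rw [fourier_coe, h1, Real.fourier_deriv h.integrable h.differentiable h2, fourier_coe]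
  simp

lemma integral_norm_sq_deriv_eq (h : 𝓢(ℝ, ℂ)) :
    ∫ s, ‖deriv h s‖ ^ 2 = ∫ ξ, (2 * Real.pi * ξ) ^ 2 * ‖𝓕 h ξ‖ ^ 2 := by
  have h0 := integral_norm_sq_fourier (derivCLM ℂ ℂ h)
  simp only [derivCLM_apply] at h0
  rw [← h0]
  congr 1; ext ξ
  rw [fourier_derivCLM_apply, norm_mul, mul_pow]
  congr 1
  simp [mul_pow]

lemma integrable_norm_sq (h : 𝓢(ℝ, ℂ)) : Integrable (fun s => ‖h s‖ ^ 2) :=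
  (memLp_two_iff_integrable_sq_norm h.continuous.aestronglyMeasurable).1 (h.memLp 2)

lemma integrable_norm_sq_deriv (h : 𝓢(ℝ, ℂ)) : Integrable (fun s => ‖deriv h s‖ ^ 2) := by
  simpa only [derivCLM_apply] using integrable_norm_sq (derivCLM ℂ ℂ h)

lemma integrable_mul_norm_sq_fourier (h : 𝓢(ℝ, ℂ)) :
    Integrable (fun ξ => (2 * Real.pi * ξ) ^ 2 * ‖𝓕 h ξ‖ ^ 2) := by
  have := integrable_norm_sq (𝓕 (derivCLM ℂ ℂ h))
  refine this.congr (.of_forall fun ξ => ?_)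
  simp only
  rw [fourier_derivCLM_apply, norm_mul, mul_pow]
  congr 1
  simp [mul_pow]

/-- Bernstein's inequality in `L²` on the line. -/
lemma integral_norm_sq_deriv_le (h : 𝓢(ℝ, ℂ)) {κ : ℝ}
    (hs : ∀ ξ, 𝓕 (h : ℝ → ℂ) ξ ≠ 0 → |ξ| ≤ κ) :
    ∫ s, ‖deriv h s‖ ^ 2 ≤ (2 * Real.pi * κ) ^ 2 * ∫ s, ‖h s‖ ^ 2 := by
  rw [integral_norm_sq_deriv_eq, ← integral_norm_sq_fourier h, ← integral_const_mul]
  refine integral_mono (integrable_mul_norm_sq_fourier h)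
    ((integrable_norm_sq (𝓕 h)).const_mul _) fun ξ => ?_
  simp only
  by_cases h0 : 𝓕 h ξ = 0
  · simp [h0]
  · gcongr ?_ * _
    have := hs ξ h0
    rw [mul_pow, mul_pow (2 * Real.pi)]
    gcongr ?_ * ?_
    exact sq_le_sq' (by linarith [neg_abs_le ξ]) ((le_abs_self ξ).trans this)

/-- Reverse Bernstein inequality in `L²` on the line. -/
lemma le_integral_norm_sq_deriv (h : 𝓢(ℝ, ℂ)) {κ : ℝ} (hκ : 0 ≤ κ)
    (hs : ∀ ξ, 𝓕 (h : ℝ → ℂ) ξ ≠ 0 → κ ≤ |ξ|) :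
    (2 * Real.pi * κ) ^ 2 * ∫ s, ‖h s‖ ^ 2 ≤ ∫ s, ‖deriv h s‖ ^ 2 := by
  rw [integral_norm_sq_deriv_eq, ← integral_norm_sq_fourier h, ← integral_const_mul]
  refine integral_mono ((integrable_norm_sq (𝓕 h)).const_mul _)
    (integrable_mul_norm_sq_fourier h) fun ξ => ?_
  simp only
  by_cases h0 : 𝓕 h ξ = 0
  · simp [h0]
  · gcongr ?_ * _
    have := hs ξ h0
    rw [mul_pow, mul_pow (2 * Real.pi), ← sq_abs ξ]
    gcongr

lemma lintegral_enorm_sq_eq (h : ℝ → ℂ) (hh : Integrable (fun s => ‖h s‖ ^ 2)) :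
    ∫⁻ s, ‖h s‖ₑ ^ 2 = ENNReal.ofReal (∫ s, ‖h s‖ ^ 2) := by
  rw [ofReal_integral_eq_lintegral_ofReal hh (.of_forall fun s => by positivity)]
  congr 1; ext s
  rw [ENNReal.ofReal_pow (norm_nonneg _), ofReal_norm]

lemma lintegral_enorm_sq_deriv_le (h : 𝓢(ℝ, ℂ)) {κ : ℝ}
    (hs : ∀ ξ, 𝓕 (h : ℝ → ℂ) ξ ≠ 0 → |ξ| ≤ κ) :
    ∫⁻ s, ‖deriv h s‖ₑ ^ 2 ≤ ENNReal.ofReal ((2 * Real.pi * κ) ^ 2) * ∫⁻ s, ‖h s‖ₑ ^ 2 := by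
  rw [lintegral_enorm_sq_eq _ (integrable_norm_sq h),
    lintegral_enorm_sq_eq _ (integrable_norm_sq_deriv h), ← ENNReal.ofReal_mul (by positivity)]
  exact ENNReal.ofReal_le_ofReal (integral_norm_sq_deriv_le h hs)

lemma le_lintegral_enorm_sq_deriv (h : 𝓢(ℝ, ℂ)) {κ : ℝ} (hκ : 0 ≤ κ)
    (hs : ∀ ξ, 𝓕 (h : ℝ → ℂ) ξ ≠ 0 → κ ≤ |ξ|) :
    ENNReal.ofReal ((2 * Real.pi * κ) ^ 2) * ∫⁻ s, ‖h s‖ₑ ^ 2 ≤ ∫⁻ s, ‖deriv h s‖ₑ ^ 2 := by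
  rw [lintegral_enorm_sq_eq _ (integrable_norm_sq h),
    lintegral_enorm_sq_eq _ (integrable_norm_sq_deriv h), ← ENNReal.ofReal_mul (by positivity)]
  exact ENNReal.ofReal_le_ofReal (le_integral_norm_sq_deriv h hκ hs)

/-- The product of a Schwartz function with the conjugate of another one. -/
def mulConj (h k : 𝓢(ℝ, ℂ)) : 𝓢(ℝ, ℂ) :=
  pairing (ContinuousLinearMap.mul ℝ ℂ) h (postcompCLM (Complex.conjCLE : ℂ →L[ℝ] ℂ) k)

lemma mulConj_apply (h k : 𝓢(ℝ, ℂ)) (s : ℝ) :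
    mulConj h k s = h s * (starRingEnd ℂ) (k s) := by
  simp [mulConj, pairing_apply_apply]

lemma fourierInv_conj (k : ℝ → ℂ) (s : ℝ) :
    𝓕⁻ (fun x => (starRingEnd ℂ) (k x)) s = (starRingEnd ℂ) (𝓕 k s) := by
  rw [Real.fourierInv_eq', Real.fourier_eq', ← integral_conj]
  congr 1; ext v
  simp [← Complex.exp_conj, map_ofNat]

/-- Frequency support of `h * conj k` when `h` has low and `k` has high frequencies. -/
lemma fourier_mulConj_support (h k : 𝓢(ℝ, ℂ)) {κ ρ : ℝ}
    (hh : ∀ ξ, 𝓕 (h : ℝ → ℂ) ξ ≠ 0 → |ξ| ≤ κ) (hk : ∀ ξ, 𝓕 (k : ℝ → ℂ) ξ ≠ 0 → ρ ≤ |ξ|)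
    (ξ : ℝ) (hξ : 𝓕 (mulConj h k : ℝ → ℂ) ξ ≠ 0) : ρ - κ ≤ |ξ| := by
  by_contra! hlt
  apply hξ
  set k' : 𝓢(ℝ, ℂ) := postcompCLM (Complex.conjCLE : ℂ →L[ℝ] ℂ) k
  have hk' : (k' : ℝ → ℂ) = fun x => (starRingEnd ℂ) (k x) := by
    ext x; simp [k']
  have e1 : mulConj h k =
      𝓕 (SchwartzMap.convolution (ContinuousLinearMap.mul ℂ ℂ) (𝓕⁻ h) (𝓕⁻ k')) := by
    rw [fourier_convolution]
    ext x
    simp [mulConj_apply, pairing_apply_apply, hk']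
  have e2 : 𝓕 (mulConj h k : ℝ → ℂ) ξ = 𝓕⁻ (mulConj h k) (-ξ) := by
    rw [fourierInv_coe, Real.fourierInv_eq_fourier_neg, neg_neg]
  rw [e2, e1, FourierTransform.fourierInv_fourier_eq, SchwartzMap.convolution_apply,
    MeasureTheory.convolution_def]
  apply integral_eq_zero_of_ae
  refine .of_forall fun t => ?_
  have e3 : (𝓕⁻ h) t = 𝓕 (h : ℝ → ℂ) (-t) := by
    rw [fourierInv_coe, Real.fourierInv_eq_fourier_neg]
  have e4 : (𝓕⁻ k') (-ξ - t) = (starRingEnd ℂ) (𝓕 (k : ℝ → ℂ) (-ξ - t)) := by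
    rw [fourierInv_coe, hk', fourierInv_conj]
  by_contra hne
  simp only [e3, e4, ContinuousLinearMap.mul_apply', Pi.zero_apply, mul_eq_zero,
    map_eq_zero, not_or] at hne
  have h1 := hh _ hne.1
  have h2 := hk _ hne.2
  have h3 : |-ξ - t| ≤ |ξ| + |-t| := by
    rw [sub_eq_add_neg]; exact (abs_add_le _ _).trans (by simp)
  linarith

/-- A kernel reproducing the derivative of functions with frequencies in `[-1, 1]`. -/
lemma exists_deriv_kernel_one : ∃ K : 𝓢(ℝ, ℂ), ∀ h : 𝓢(ℝ, ℂ),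
    (∀ ξ, 𝓕 (h : ℝ → ℂ) ξ ≠ 0 → |ξ| ≤ 1) →
    ∀ s, ‖deriv h s‖ₑ ≤ ∫⁻ w, ‖K w‖ₑ * ‖h (s - w)‖ₑ := by
  let φ : ContDiffBump (0 : ℝ) := ⟨1, 2, by norm_num, by norm_num⟩
  have hη : ContDiff ℝ ∞ (fun ξ : ℝ => (2 * Real.pi * Complex.I * ξ) * (φ ξ : ℂ)) := by
    have h1 : ContDiff ℝ ∞ (fun ξ : ℝ => (φ ξ : ℂ)) := Complex.ofRealCLM.contDiff.comp φ.contDiff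
    have h2 : ContDiff ℝ ∞ (fun ξ : ℝ => (ξ : ℂ)) := Complex.ofRealCLM.contDiff
    exact (contDiff_const.mul h2).mul h1
  have hc : HasCompactSupport (fun ξ : ℝ => (2 * Real.pi * Complex.I * ξ) * (φ ξ : ℂ)) := by
    apply HasCompactSupport.mul_left
    exact φ.hasCompactSupport.comp_left (g := Complex.ofReal) rfl
  let η : 𝓢(ℝ, ℂ) := hc.toSchwartzMap hη
  refine ⟨𝓕⁻ η, fun h hh s => ?_⟩
  have e1 : SchwartzMap.convolution (ContinuousLinearMap.mul ℂ ℂ) (𝓕⁻ η) h = derivCLM ℂ ℂ h := by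
    have : 𝓕 (SchwartzMap.convolution (ContinuousLinearMap.mul ℂ ℂ) (𝓕⁻ η) h) =
        𝓕 (derivCLM ℂ ℂ h) := by
      rw [fourier_convolution]
      ext ξ
      rw [fourier_derivCLM_apply]
      simp only [pairing_apply_apply, FourierTransform.fourier_fourierInv_eq,
        ContinuousLinearMap.mul_apply', η, HasCompactSupport.toSchwartzMap_toFun]
      by_cases h0 : 𝓕 h ξ = 0
      · simp [h0]
      · have : φ ξ = 1 := φ.one_of_mem_closedBall (by simpa using hh ξ h0)
        simp [this]
    have h2 := congrArg (fun g : 𝓢(ℝ, ℂ) => 𝓕⁻ g) this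
    simpa only [FourierTransform.fourierInv_fourier_eq] using h2
  have e2 : deriv h s = ∫ w, (𝓕⁻ η) w * h (s - w) := by
    rw [← derivCLM_apply ℂ, ← e1, SchwartzMap.convolution_apply, MeasureTheory.convolution_def]
    simp
  rw [e2]
  refine (enorm_integral_le_lintegral_enorm _).trans_eq ?_
  simp [enorm_mul]

lemma exists_deriv_kernel : ∃ K : 𝓢(ℝ, ℂ), ∀ κ : ℝ, 0 < κ → ∀ h : 𝓢(ℝ, ℂ),
    (∀ ξ, 𝓕 (h : ℝ → ℂ) ξ ≠ 0 → |ξ| ≤ κ) →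
    ∀ s, ‖deriv h s‖ₑ ≤ ENNReal.ofReal κ * ∫⁻ w, ‖K w‖ₑ * ‖h (s - w / κ)‖ₑ := by
  obtain ⟨K, hK⟩ := exists_deriv_kernel_one
  refine ⟨K, fun κ hκ h hh s => ?_⟩
  let e : ℝ ≃L[ℝ] ℝ := ContinuousLinearEquiv.smulLeft (Units.mk0 κ⁻¹ (by positivity))
  have he : ∀ x, e x = x / κ := fun x => by
    simp [e, Units.smul_def, div_eq_inv_mul]
  let h' : 𝓢(ℝ, ℂ) := compCLMOfContinuousLinearEquiv ℂ e h
  have hh' : ∀ x, h' x = h (x / κ) := fun x => by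
    simp [h', he]
  have hder : deriv h (s) = κ * deriv h' (κ * s) := by
    have h1 : HasDerivAt h' (deriv h s * (1 / κ : ℝ)) (κ * s) := by
      have : HasDerivAt (fun x : ℝ => x / κ) (1 / κ) (κ * s) := (hasDerivAt_id _).div_const κ
      have h2 : HasDerivAt h (deriv h s) (κ * s / κ) := by
        rw [mul_div_cancel_left₀ _ hκ.ne']; exact h.hasDerivAt s
      have h3 := h2.scomp (κ * s) this
      rw [show (h' : ℝ → ℂ) = (h : ℝ → ℂ) ∘ fun x => x / κ from funext hh']
      rwa [Complex.real_smul, mul_comm] at h3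
    rw [h1.deriv]
    have : (κ : ℂ) ≠ 0 := by exact_mod_cast hκ.ne'
    push_cast
    field_simp
  have hsupp : ∀ ξ, 𝓕 (h' : ℝ → ℂ) ξ ≠ 0 → |ξ| ≤ 1 := by
    intro ξ hξ
    have : 𝓕 (h' : ℝ → ℂ) ξ = κ * 𝓕 (h : ℝ → ℂ) (κ * ξ) := by
      rw [Real.fourier_eq', Real.fourier_eq']
      have := Measure.integral_comp_div
        (fun v : ℝ => Complex.exp ((↑(-2 * Real.pi * inner ℝ v (κ * ξ)) * Complex.I)) • h v) κ
      rw [abs_of_pos hκ, Complex.real_smul] at this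
      rw [← this]
      congr 1; ext v
      rw [hh']
      congr 5
      simp only [RCLike.inner_apply, conj_trivial]
      field_simp
    rw [this] at hξ
    have := hh _ (right_ne_zero_of_mul hξ)
    rw [abs_mul, abs_of_pos hκ] at this
    nlinarith
  rw [hder, enorm_mul]
  have := hK h' hsupp (κ * s)
  refine mul_le_mul' (le_of_eq ?_) (this.trans_eq ?_)
  · rw [← ofReal_norm]; simp [abs_of_pos hκ]
  · congr 1; ext w
    rw [hh']
    congr 3
    field_simp

end

section
open Function Set

lemma intervalIntegral_add_of_continuous {f g : ℝ → ℝ} (hf : Continuous f) (hg : Continuous g)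
    (a b : ℝ) : ∫ x in a..b, (f x + g x) = (∫ x in a..b, f x) + ∫ x in a..b, g x :=
  intervalIntegral.integral_add (hf.intervalIntegrable _ _) (hg.intervalIntegrable _ _)

lemma intervalIntegral_sub_of_continuous {f g : ℝ → ℝ} (hf : Continuous f) (hg : Continuous g)
    (a b : ℝ) : ∫ x in a..b, (f x - g x) = (∫ x in a..b, f x) - ∫ x in a..b, g x :=
  intervalIntegral.integral_sub (hf.intervalIntegrable _ _) (hg.intervalIntegrable _ _)

lemma integral_eq_sub_of_hasDerivAt_of_continuous {f f' : ℝ → ℝ} (hf' : Continuous f')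
    (h : ∀ x, HasDerivAt f (f' x) x) (a b : ℝ) : ∫ x in a..b, f' x = f b - f a :=
  intervalIntegral.integral_eq_sub_of_hasDerivAt (fun x _ => h x) (hf'.intervalIntegrable _ _)

/-- Differentiation under the integral sign for jointly continuous derivatives. -/
lemma hasDerivAt_intervalIntegral_param {F F' : ℝ → ℝ → ℝ} (a b : ℝ)
    (hF : Continuous (uncurry F)) (hF' : Continuous (uncurry F'))
    (h : ∀ x z, HasDerivAt (fun x => F x z) (F' x z) x) (x : ℝ) :
    HasDerivAt (fun x => ∫ z in a..b, F x z) (∫ z in a..b, F' x z) x := by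
  obtain ⟨M, hM⟩ := ((isCompact_Icc (a := x - 1) (b := x + 1)).prod
    (isCompact_uIcc (a := a) (b := b))).exists_bound_of_continuousOn hF'.continuousOn
  refine (intervalIntegral.hasDerivAt_integral_of_dominated_loc_of_deriv_le
    (bound := fun _ => M) (Icc_mem_nhds (a := x - 1) (b := x + 1) (by linarith) (by linarith))
    (.of_forall fun y => ?_) ?_ ?_ ?_ ?_ ?_).2
  · exact (hF.comp (by fun_prop : Continuous fun z : ℝ => (y, z))).aestronglyMeasurable
  · exact (hF.comp (by fun_prop : Continuous fun z : ℝ => (x, z))).intervalIntegrable _ _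
  · exact (hF'.comp (by fun_prop : Continuous fun z : ℝ => (x, z))).aestronglyMeasurable
  · exact .of_forall fun z hz y hy => hM (y, z) ⟨hy, uIoc_subset_uIcc hz⟩
  · exact intervalIntegrable_const
  · exact .of_forall fun z _ y _ => h y z

lemma abs_intervalIntegral_le_of_mem {R s : ℝ} {f : ℝ → ℝ} (hf : Continuous f)
    (hs : s ∈ Icc (-R) R) : |∫ x in (-R)..s, f x| ≤ ∫ x in (-R)..R, |f x| := by
  refine (intervalIntegral.abs_integral_le_integral_abs hs.1).trans ?_
  exact intervalIntegral.integral_mono_interval le_rfl hs.1 hs.2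
    (.of_forall fun _ => abs_nonneg _) (hf.abs.intervalIntegrable _ _)

lemma abs_integral_mul_le_of_bound {R c : ℝ} (hR : 0 ≤ R) {f g : ℝ → ℝ} (hf : Continuous f)
    (hg : Continuous g) (h : ∀ s ∈ Icc (-R) R, |g s| ≤ c) :
    |∫ x in (-R)..R, f x * g x| ≤ (∫ x in (-R)..R, |f x|) * c := by
  refine (intervalIntegral.abs_integral_le_integral_abs (by linarith)).trans ?_
  rw [← intervalIntegral.integral_mul_const]
  refine intervalIntegral.integral_mono_on (by linarith) ((hf.mul hg).abs.intervalIntegrable _ _)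
    ((hf.abs.mul continuous_const).intervalIntegrable _ _) fun x hx => ?_
  rw [abs_mul]
  exact mul_le_mul_of_nonneg_left (h x hx) (abs_nonneg _)

/-- The balance law `∂_t f + ∂_s p = g` on the strip `|s| ≤ R`, the flux `p` vanishing at the
endpoints. -/
structure BalanceLaw (R : ℝ) (f p g : ℝ → ℝ → ℝ) : Prop where
  density_cont : Continuous (uncurry f)
  flux_cont : Continuous (uncurry p)
  source_cont : Continuous (uncurry g)
  law : ∃ f' : ℝ → ℝ → ℝ, Continuous (uncurry f') ∧
    (∀ t s, HasDerivAt (fun t => f t s) (f' t s) t) ∧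
    ∀ t s, HasDerivAt (fun s => p t s) (g t s - f' t s) s
  flux_left : ∀ t, p t (-R) = 0
  flux_right : ∀ t, p t R = 0

/-- The div-curl lemma for two balance laws in `1 + 1` dimensions. -/
lemma BalanceLaw.div_curl {R T A₁ A₂ Γ₁ Γ₂ : ℝ} (hR : 0 ≤ R) (hT : 0 ≤ T)
    {f₁ p₁ g₁ f₂ p₂ g₂ : ℝ → ℝ → ℝ} (h₁ : BalanceLaw R f₁ p₁ g₁) (h₂ : BalanceLaw R f₂ p₂ g₂)
    (hA₁ : ∀ t, ∫ s in (-R)..R, |f₁ t s| ≤ A₁) (hA₂ : ∀ t, ∫ s in (-R)..R, |f₂ t s| ≤ A₂)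
    (hΓ₁ : ∫ t in (-T)..T, ∫ s in (-R)..R, |g₁ t s| ≤ Γ₁)
    (hΓ₂ : ∫ t in (-T)..T, ∫ s in (-R)..R, |g₂ t s| ≤ Γ₂) :
    ∫ t in (-T)..T, ∫ s in (-R)..R, (f₁ t s * p₂ t s - p₁ t s * f₂ t s) ≤
      2 * A₁ * A₂ + Γ₁ * A₂ + A₁ * Γ₂ := by
  obtain ⟨f₁', hf₁', hd₁, hp₁⟩ := h₁.law
  obtain ⟨f₂', hf₂', hd₂, hp₂⟩ := h₂.law
  have cf₁ := h₁.density_cont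
  have cp₁ := h₁.flux_cont
  have cg₁ := h₁.source_cont
  have cf₂ := h₂.density_cont
  have cp₂ := h₂.flux_cont
  have cg₂ := h₂.source_cont
  have slice : ∀ {f : ℝ → ℝ → ℝ}, Continuous (uncurry f) → ∀ t, Continuous (f t) :=
    fun hf t => hf.comp (by fun_prop : Continuous fun z : ℝ => (t, z))
  have line : ∀ {f : ℝ → ℝ → ℝ}, Continuous (uncurry f) →
      Continuous (fun t => ∫ s in (-R)..R, f t s) := fun hf =>
    intervalIntegral.continuous_parametric_intervalIntegral_of_continuous' hf _ _
  have prim : ∀ {f : ℝ → ℝ → ℝ}, Continuous (uncurry f) →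
      Continuous (uncurry fun t s => ∫ x in (-R)..s, f t x) := fun {f} hf =>
    intervalIntegral.continuous_parametric_intervalIntegral_of_continuous
      (f := fun (q : ℝ × ℝ) x => f q.1 x)
      (hf.comp (by fun_prop : Continuous fun q : (ℝ × ℝ) × ℝ => (q.1.1, q.2))) continuous_snd
  have A₁0 : 0 ≤ A₁ := (intervalIntegral.integral_nonneg (by linarith)
    fun _ _ => abs_nonneg _).trans (hA₁ 0)
  have A₂0 : 0 ≤ A₂ := (intervalIntegral.integral_nonneg (by linarith)
    fun _ _ => abs_nonneg _).trans (hA₂ 0)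
  set F : ℝ → ℝ → ℝ := fun t s => ∫ x in (-R)..s, f₂ t x with hF
  set G : ℝ → ℝ → ℝ := fun t s => ∫ x in (-R)..s, g₂ t x with hG
  have cF : Continuous (uncurry F) := prim cf₂
  have cG : Continuous (uncurry G) := prim cg₂
  have dF : ∀ t s, HasDerivAt (fun t => F t s) (G t s - p₂ t s) t := by
    intro t s
    have h := hasDerivAt_intervalIntegral_param (-R) s cf₂ hf₂' hd₂ t
    convert h using 1
    have : ∫ x in (-R)..s, (g₂ t x - f₂' t x) = p₂ t s - p₂ t (-R) :=
      intervalIntegral.integral_eq_sub_of_hasDerivAt (fun x _ => hp₂ t x)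
        (((slice cg₂ t).sub (slice hf₂' t)).intervalIntegrable _ _)
    rw [intervalIntegral.integral_sub ((slice cg₂ t).intervalIntegrable _ _)
      ((slice hf₂' t).intervalIntegrable _ _), h₂.flux_left t] at this
    simp only [hG]; linarith
  have dF' : ∀ t s, HasDerivAt (fun s => F t s) (f₂ t s) s := fun t s =>
    intervalIntegral.integral_hasDerivAt_right ((slice cf₂ t).intervalIntegrable _ _)
      ((slice cf₂ t).stronglyMeasurableAtFilter _ _) (slice cf₂ t).continuousAt
  have dΦ : ∀ t, HasDerivAt (fun t => ∫ s in (-R)..R, f₁ t s * F t s)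
      (∫ s in (-R)..R, (f₁' t s * F t s + f₁ t s * (G t s - p₂ t s))) t := fun t =>
    hasDerivAt_intervalIntegral_param (-R) R (F := fun t s => f₁ t s * F t s)
      (F' := fun t s => f₁' t s * F t s + f₁ t s * (G t s - p₂ t s))
      (cf₁.mul cF) ((hf₁'.mul cF).add (cf₁.mul (cG.sub cp₂)))
      (fun t s => (hd₁ t s).mul (dF t s)) t
  have parts : ∀ t, ∫ s in (-R)..R, ((g₁ t s - f₁' t s) * F t s + p₁ t s * f₂ t s) = 0 := by
    intro t
    have h := integral_eq_sub_of_hasDerivAt_of_continuous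
      ((((slice cg₁ t).sub (slice hf₁' t)).mul (slice cF t)).add
        ((slice cp₁ t).mul (slice cf₂ t))) (fun x => (hp₁ t x).mul (dF' t x)) (-R) R
    simpa [h₁.flux_left, h₁.flux_right] using h
  have key : ∀ t, ∫ s in (-R)..R, (f₁ t s * p₂ t s - p₁ t s * f₂ t s) =
      (∫ s in (-R)..R, g₁ t s * F t s) + (∫ s in (-R)..R, f₁ t s * G t s) -
      ∫ s in (-R)..R, (f₁' t s * F t s + f₁ t s * (G t s - p₂ t s)) := by
    intro t
    have i1 := (slice cg₁ t).mul (slice cF t)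
    have i2 := (slice cf₁ t).mul (slice cG t)
    have i3 := ((slice hf₁' t).mul (slice cF t)).add
      ((slice cf₁ t).mul ((slice cG t).sub (slice cp₂ t)))
    have i4 := (((slice cg₁ t).sub (slice hf₁' t)).mul (slice cF t)).add
        ((slice cp₁ t).mul (slice cf₂ t))
    have e := intervalIntegral_sub_of_continuous ((i1.add i2).sub i3) i4 (-R) R
    have e' := intervalIntegral_sub_of_continuous (i1.add i2) i3 (-R) R
    have e'' := intervalIntegral_add_of_continuous i1 i2 (-R) R
    simp only [Pi.add_apply, Pi.sub_apply, Pi.mul_apply] at e e' e''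
    rw [parts t, sub_zero] at e
    rw [← e'', ← e', ← e]
    congr 1; ext s; ring
  have cΦ' : Continuous fun t =>
      ∫ s in (-R)..R, (f₁' t s * F t s + f₁ t s * (G t s - p₂ t s)) :=
    line (f := fun t s => f₁' t s * F t s + f₁ t s * (G t s - p₂ t s))
      ((hf₁'.mul cF).add (cf₁.mul (cG.sub cp₂)))
  have c1 : Continuous fun t => ∫ s in (-R)..R, g₁ t s * F t s :=
    line (f := fun t s => g₁ t s * F t s) (cg₁.mul cF)
  have c2 : Continuous fun t => ∫ s in (-R)..R, f₁ t s * G t s :=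
    line (f := fun t s => f₁ t s * G t s) (cf₁.mul cG)
  have c3 : Continuous fun t => ∫ s in (-R)..R, |g₁ t s| :=
    line (f := fun t s => |g₁ t s|) cg₁.abs
  have c4 : Continuous fun t => ∫ s in (-R)..R, |g₂ t s| :=
    line (f := fun t s => |g₂ t s|) cg₂.abs
  have bF : ∀ t, ∀ s ∈ Icc (-R) R, |F t s| ≤ A₂ := fun t s hs =>
    (abs_intervalIntegral_le_of_mem (slice cf₂ t) hs).trans (hA₂ t)
  have bΦ : ∀ t, |∫ s in (-R)..R, f₁ t s * F t s| ≤ A₁ * A₂ := fun t =>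
    (abs_integral_mul_le_of_bound hR (slice cf₁ t) (slice cF t) (bF t)).trans
      (mul_le_mul_of_nonneg_right (hA₁ t) A₂0)
  have b1 : ∫ t in (-T)..T, ∫ s in (-R)..R, g₁ t s * F t s ≤ Γ₁ * A₂ := by
    refine le_trans ?_ (mul_le_mul_of_nonneg_right hΓ₁ A₂0)
    rw [← intervalIntegral.integral_mul_const]
    exact intervalIntegral.integral_mono (by linarith) (c1.intervalIntegrable _ _)
      ((c3.mul continuous_const).intervalIntegrable _ _) fun t => (le_abs_self _).trans
      (abs_integral_mul_le_of_bound hR (slice cg₁ t) (slice cF t) (bF t))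
  have b2 : ∫ t in (-T)..T, ∫ s in (-R)..R, f₁ t s * G t s ≤ A₁ * Γ₂ := by
    refine le_trans ?_ (mul_le_mul_of_nonneg_left hΓ₂ A₁0)
    rw [← intervalIntegral.integral_const_mul]
    exact intervalIntegral.integral_mono (by linarith) (c2.intervalIntegrable _ _)
      ((continuous_const.mul c4).intervalIntegrable _ _) fun t => (le_abs_self _).trans
      ((abs_integral_mul_le_of_bound hR (slice cf₁ t) (slice cG t) fun s hs =>
        abs_intervalIntegral_le_of_mem (slice cg₂ t) hs).trans
        (mul_le_mul_of_nonneg_right (hA₁ t)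
          (intervalIntegral.integral_nonneg (by linarith) fun _ _ => abs_nonneg _)))
  simp_rw [key]
  have e := intervalIntegral_sub_of_continuous (c1.add c2) cΦ' (-T) T
  simp only [Pi.add_apply] at e
  rw [e, intervalIntegral_add_of_continuous c1 c2,
    integral_eq_sub_of_hasDerivAt_of_continuous cΦ' dΦ]
  have h3 := abs_le.1 (bΦ T)
  have h4 := abs_le.1 (bΦ (-T))
  linarith [h3.1, h4.2]

end

section
open Function Set Topology
open scoped ContDiff

/-- The directional derivative of a function of `(t, s, z)`. -/
def pd {E : Type*} [NormedAddCommGroup E] [NormedSpace ℝ E] (e : ℝ × ℝ × ℝ) (f : ℝ × ℝ × ℝ → E)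
    (p : ℝ × ℝ × ℝ) : E := fderiv ℝ f p e

/-- The time direction. -/
abbrev e₀ : ℝ × ℝ × ℝ := (1, 0, 0)
/-- The first spatial direction. -/
abbrev e₁ : ℝ × ℝ × ℝ := (0, 1, 0)
/-- The second spatial direction. -/
abbrev e₂ : ℝ × ℝ × ℝ := (0, 0, 1)

section pd
variable {E : Type*} [NormedAddCommGroup E] [NormedSpace ℝ E]

@[fun_prop]
lemma contDiff_pd {e : ℝ × ℝ × ℝ} {f : ℝ × ℝ × ℝ → E} (hf : ContDiff ℝ ∞ f) :
    ContDiff ℝ ∞ (pd e f) :=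
  (hf.fderiv_right (m := ∞) (by simp)).clm_apply contDiff_const

lemma hasDerivAt_pd_zero {f : ℝ × ℝ × ℝ → E} (hf : ContDiff ℝ ∞ f) (t s z : ℝ) :
    HasDerivAt (fun t => f (t, s, z)) (pd e₀ f (t, s, z)) t := by
  have h : HasDerivAt (fun t : ℝ => (t, s, z)) e₀ t :=
    (hasDerivAt_id t).prodMk (hasDerivAt_const t (s, z))
  exact ((hf.differentiable (by simp)) (t, s, z)).hasFDerivAt.comp_hasDerivAt t h

lemma hasDerivAt_pd_one {f : ℝ × ℝ × ℝ → E} (hf : ContDiff ℝ ∞ f) (t s z : ℝ) :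
    HasDerivAt (fun s => f (t, s, z)) (pd e₁ f (t, s, z)) s := by
  have h : HasDerivAt (fun s : ℝ => (t, s, z)) e₁ s :=
    (hasDerivAt_const s t).prodMk ((hasDerivAt_id s).prodMk (hasDerivAt_const s z))
  exact ((hf.differentiable (by simp)) (t, s, z)).hasFDerivAt.comp_hasDerivAt s h

lemma hasDerivAt_pd_two {f : ℝ × ℝ × ℝ → E} (hf : ContDiff ℝ ∞ f) (t s z : ℝ) :
    HasDerivAt (fun z => f (t, s, z)) (pd e₂ f (t, s, z)) z := by
  have h : HasDerivAt (fun z : ℝ => (t, s, z)) e₂ z :=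
    (hasDerivAt_const z t).prodMk ((hasDerivAt_const z s).prodMk (hasDerivAt_id z))
  exact ((hf.differentiable (by simp)) (t, s, z)).hasFDerivAt.comp_hasDerivAt z h

lemma pd_comm {f : ℝ × ℝ × ℝ → E} (hf : ContDiff ℝ ∞ f) (e e' : ℝ × ℝ × ℝ) :
    pd e (pd e' f) = pd e' (pd e f) := by
  have key : ∀ v w : ℝ × ℝ × ℝ, ∀ p, pd v (pd w f) p = fderiv ℝ (fderiv ℝ f) p v w := by
    intro v w p
    have h1 : DifferentiableAt ℝ (fderiv ℝ f) p :=
      (hf.fderiv_right (m := ∞) (by simp)).differentiable (by simp) p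
    have h2 := h1.hasFDerivAt.clm_apply (hasFDerivAt_const w p)
    change fderiv ℝ (fun q => fderiv ℝ f q w) p v = _
    rw [h2.fderiv]
    simp
  ext p
  rw [key, key]
  exact (hf.contDiffAt.isSymmSndFDerivAt (by
    rw [minSmoothness_of_isRCLikeNormedField]; exact WithTop.coe_le_coe.2 le_top)).eq _ _

lemma pd_add {e : ℝ × ℝ × ℝ} {f g : ℝ × ℝ × ℝ → E} (hf : ContDiff ℝ ∞ f) (hg : ContDiff ℝ ∞ g)
    (p : ℝ × ℝ × ℝ) : pd e (fun x => f x + g x) p = pd e f p + pd e g p := by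
  simp only [pd]
  rw [fderiv_fun_add (hf.differentiable (by simp) p) (hg.differentiable (by simp) p)]
  rfl

lemma pd_sub {e : ℝ × ℝ × ℝ} {f g : ℝ × ℝ × ℝ → E} (hf : ContDiff ℝ ∞ f) (hg : ContDiff ℝ ∞ g)
    (p : ℝ × ℝ × ℝ) : pd e (fun x => f x - g x) p = pd e f p - pd e g p := by
  simp only [pd]
  rw [fderiv_fun_sub (hf.differentiable (by simp) p) (hg.differentiable (by simp) p)]
  rfl

lemma pd_mul {A : Type*} [NormedCommRing A] [NormedAlgebra ℝ A] {e : ℝ × ℝ × ℝ}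
    {f g : ℝ × ℝ × ℝ → A} (hf : ContDiff ℝ ∞ f) (hg : ContDiff ℝ ∞ g)
    (p : ℝ × ℝ × ℝ) : pd e (fun x => f x * g x) p = pd e f p * g p + f p * pd e g p := by
  simp only [pd]
  rw [fderiv_fun_mul (hf.differentiable (by simp) p) (hg.differentiable (by simp) p)]
  simp [mul_comm, add_comm]

lemma pd_neg {e : ℝ × ℝ × ℝ} (f : ℝ × ℝ × ℝ → E) (p : ℝ × ℝ × ℝ) :
    pd e (fun x => -f x) p = -pd e f p := by
  simp only [pd]
  rw [fderiv_fun_neg]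
  rfl

lemma pd_const {e : ℝ × ℝ × ℝ} (c : E) (p : ℝ × ℝ × ℝ) : pd e (fun _ => c) p = 0 := by
  simp [pd]

lemma pd_re {e : ℝ × ℝ × ℝ} {U : ℝ × ℝ × ℝ → ℂ} (hU : ContDiff ℝ ∞ U) (p : ℝ × ℝ × ℝ) :
    pd e (fun x => (U x).re) p = (pd e U p).re := by
  have := Complex.reCLM.hasFDerivAt.comp p (hU.differentiable (by simp) p).hasFDerivAt
  simp only [pd]
  rw [show (fun x => (U x).re) = Complex.reCLM ∘ U from rfl, this.fderiv]; rfl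

lemma pd_im {e : ℝ × ℝ × ℝ} {U : ℝ × ℝ × ℝ → ℂ} (hU : ContDiff ℝ ∞ U) (p : ℝ × ℝ × ℝ) :
    pd e (fun x => (U x).im) p = (pd e U p).im := by
  have := Complex.imCLM.hasFDerivAt.comp p (hU.differentiable (by simp) p).hasFDerivAt
  simp only [pd]
  rw [show (fun x => (U x).im) = Complex.imCLM ∘ U from rfl, this.fderiv]; rfl

end pd

/-- The operator `i∂_t + a(∂₁² − ∂₂²)`. -/
def waveOp (a : ℝ) (U : ℝ × ℝ × ℝ → ℂ) (p : ℝ × ℝ × ℝ) : ℂ :=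
  Complex.I * pd e₀ U p + a * (pd e₁ (pd e₁ U) p - pd e₂ (pd e₂ U) p)

@[fun_prop]
lemma contDiff_waveOp {a : ℝ} {U : ℝ × ℝ × ℝ → ℂ} (hU : ContDiff ℝ ∞ U) :
    ContDiff ℝ ∞ (waveOp a U) := by
  unfold waveOp; fun_prop

/-- Mass density. -/
def massDensity (U : ℝ × ℝ × ℝ → ℂ) (p : ℝ × ℝ × ℝ) : ℝ :=
  (U p).re * (U p).re + (U p).im * (U p).im

/-- Momentum density in the first direction. -/
def momentumDensity (a : ℝ) (U : ℝ × ℝ × ℝ → ℂ) (p : ℝ × ℝ × ℝ) : ℝ :=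
  2 * a * ((U p).re * (pd e₁ U p).im - (U p).im * (pd e₁ U p).re)

/-- The source of mass. -/
def massSource (a : ℝ) (U : ℝ × ℝ × ℝ → ℂ) (p : ℝ × ℝ × ℝ) : ℝ :=
  2 * ((U p).re * (waveOp a U p).im - (U p).im * (waveOp a U p).re)

/-- The source of momentum. -/
def momentumSource (a : ℝ) (U : ℝ × ℝ × ℝ → ℂ) (p : ℝ × ℝ × ℝ) : ℝ :=
  4 * a * ((waveOp a U p).re * (pd e₁ U p).re + (waveOp a U p).im * (pd e₁ U p).im)

/-- The pairing of `U` with the source term, appearing in the flux of momentum. -/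
def sourcePairing (a : ℝ) (U : ℝ × ℝ × ℝ → ℂ) (p : ℝ × ℝ × ℝ) : ℝ :=
  2 * a * ((U p).re * (waveOp a U p).re + (U p).im * (waveOp a U p).im)

/-- The flux of momentum in the first direction. -/
def momentumFlux (a : ℝ) (U : ℝ × ℝ × ℝ → ℂ) (p : ℝ × ℝ × ℝ) : ℝ :=
  2 * ((pd e₁ U p).re * (pd e₁ U p).re + (pd e₁ U p).im * (pd e₁ U p).im)
    - 2 * ((U p).re * (pd e₁ (pd e₁ U) p).re + (U p).im * (pd e₁ (pd e₁ U) p).im)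
    + sourcePairing a U p

@[fun_prop]
lemma contDiff_re {U : ℝ × ℝ × ℝ → ℂ} (hU : ContDiff ℝ ∞ U) : ContDiff ℝ ∞ fun p => (U p).re :=
  Complex.reCLM.contDiff.comp hU

@[fun_prop]
lemma contDiff_im {U : ℝ × ℝ × ℝ → ℂ} (hU : ContDiff ℝ ∞ U) : ContDiff ℝ ∞ fun p => (U p).im :=
  Complex.imCLM.contDiff.comp hU

lemma waveOp_re (a : ℝ) (U : ℝ × ℝ × ℝ → ℂ) (p : ℝ × ℝ × ℝ) : (waveOp a U p).re =
    -(pd e₀ U p).im + a * ((pd e₁ (pd e₁ U) p).re - (pd e₂ (pd e₂ U) p).re) := by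
  simp [waveOp]

lemma waveOp_im (a : ℝ) (U : ℝ × ℝ × ℝ → ℂ) (p : ℝ × ℝ × ℝ) : (waveOp a U p).im =
    (pd e₀ U p).re + a * ((pd e₁ (pd e₁ U) p).im - (pd e₂ (pd e₂ U) p).im) := by
  simp [waveOp]

section laws
variable {a : ℝ} {U : ℝ × ℝ × ℝ → ℂ} (hU : ContDiff ℝ ∞ U)
include hU

lemma contDiff_massDensity : ContDiff ℝ ∞ (massDensity U) := by unfold massDensity; fun_prop
lemma contDiff_momentumDensity : ContDiff ℝ ∞ (momentumDensity a U) := by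
  unfold momentumDensity; fun_prop
lemma contDiff_massSource : ContDiff ℝ ∞ (massSource a U) := by unfold massSource; fun_prop
lemma contDiff_momentumSource : ContDiff ℝ ∞ (momentumSource a U) := by
  unfold momentumSource; fun_prop
lemma contDiff_sourcePairing : ContDiff ℝ ∞ (sourcePairing a U) := by
  unfold sourcePairing; fun_prop
lemma contDiff_momentumFlux : ContDiff ℝ ∞ (momentumFlux a U) := by
  have := contDiff_sourcePairing (a := a) hU
  unfold momentumFlux; fun_prop

lemma pd_massDensity (e p : ℝ × ℝ × ℝ) : pd e (massDensity U) p =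
    2 * ((U p).re * (pd e U p).re + (U p).im * (pd e U p).im) := by
  unfold massDensity
  simp (disch := fun_prop) only [pd_add, pd_mul, pd_re, pd_im]
  ring

/-- The local conservation law of mass. -/
lemma mass_law (p : ℝ × ℝ × ℝ) : pd e₀ (massDensity U) p + pd e₁ (momentumDensity a U) p
    + pd e₂ (fun p => -2 * a * ((U p).re * (pd e₂ U p).im - (U p).im * (pd e₂ U p).re)) p =
    massSource a U p := by
  rw [pd_massDensity hU]
  unfold momentumDensity massSource
  rw [waveOp_re, waveOp_im]
  simp (disch := fun_prop) only [pd_sub, pd_mul, pd_re, pd_im, pd_const]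
  ring

/-- The local conservation law of momentum. -/
lemma momentum_law (ha : a * a = 1) (p : ℝ × ℝ × ℝ) :
    pd e₀ (momentumDensity a U) p + pd e₁ (momentumFlux a U) p
    + pd e₂ (fun p => 2 * ((U p).re * (pd e₂ (pd e₁ U) p).re + (U p).im * (pd e₂ (pd e₁ U) p).im
      - (pd e₁ U p).re * (pd e₂ U p).re - (pd e₁ U p).im * (pd e₂ U p).im)) p =
    momentumSource a U p := by
  unfold momentumDensity momentumFlux momentumSource sourcePairing
  simp only [waveOp_re, waveOp_im]
  simp (disch := fun_prop) only [pd_add, pd_sub, pd_mul, pd_re, pd_im, pd_const, pd_neg]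
  have h1 : pd e₁ (pd e₂ (pd e₂ U)) = pd e₂ (pd e₂ (pd e₁ U)) := by
    rw [pd_comm (contDiff_pd hU) e₁ e₂, pd_comm hU e₁ e₂]
  rw [pd_comm hU e₁ e₀, h1]
  linear_combination (2 * ((pd e₁ U p).re * ((pd e₁ (pd e₁ U) p).re - (pd e₂ (pd e₂ U) p).re)
    + (pd e₁ U p).im * ((pd e₁ (pd e₁ U) p).im - (pd e₂ (pd e₂ U) p).im)
    + (U p).re * ((pd e₁ (pd e₁ (pd e₁ U)) p).re - (pd e₂ (pd e₂ (pd e₁ U)) p).re)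
    + (U p).im * ((pd e₁ (pd e₁ (pd e₁ U)) p).im - (pd e₂ (pd e₂ (pd e₁ U)) p).im))
    - 4 * ((pd e₁ U p).re * ((pd e₁ (pd e₁ U) p).re - (pd e₂ (pd e₂ U) p).re)
    + (pd e₁ U p).im * ((pd e₁ (pd e₁ U) p).im - (pd e₂ (pd e₂ U) p).im))) * ha

end laws

end

section
open Function Set Topology
open scoped ContDiff

lemma intervalIntegral_linear_comb {f₁ f₂ f₃ f₄ : ℝ → ℝ} (h₁ : Continuous f₁)
    (h₂ : Continuous f₂) (h₃ : Continuous f₃) (h₄ : Continuous f₄) (c₁ c₂ c₃ c₄ a b : ℝ) :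
    ∫ x in a..b, (c₁ * f₁ x + c₂ * f₂ x + c₃ * f₃ x + c₄ * f₄ x) =
      c₁ * (∫ x in a..b, f₁ x) + c₂ * (∫ x in a..b, f₂ x) + c₃ * (∫ x in a..b, f₃ x)
        + c₄ * ∫ x in a..b, f₄ x := by
  rw [intervalIntegral_add_of_continuous (by fun_prop) (by fun_prop),
    intervalIntegral_add_of_continuous (by fun_prop) (by fun_prop),
    intervalIntegral_add_of_continuous (by fun_prop) (by fun_prop)]
  simp only [intervalIntegral.integral_const_mul]

/-- Integration over `|z| ≤ R`. -/
def zInt (R : ℝ) (h : ℝ × ℝ × ℝ → ℝ) (t s : ℝ) : ℝ := ∫ z in (-R)..R, h (t, s, z)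

lemma continuous_zInt {R : ℝ} {h : ℝ × ℝ × ℝ → ℝ} (hh : Continuous h) :
    Continuous (uncurry (zInt R h)) := by
  refine intervalIntegral.continuous_parametric_intervalIntegral_of_continuous'
    (f := fun (q : ℝ × ℝ) z => h (q.1, q.2, z)) ?_ _ _
  exact hh.comp (by fun_prop : Continuous fun q : (ℝ × ℝ) × ℝ => (q.1.1, q.1.2, q.2))

lemma Continuous.uncurry_slice {f : ℝ → ℝ → ℝ} (hf : Continuous (uncurry f)) (t : ℝ) :
    Continuous (f t) := hf.comp (by fun_prop : Continuous fun z : ℝ => (t, z))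

lemma Continuous.uncurry_integral {f : ℝ → ℝ → ℝ} (hf : Continuous (uncurry f)) (a b : ℝ) :
    Continuous (fun t => ∫ s in a..b, f t s) :=
  intervalIntegral.continuous_parametric_intervalIntegral_of_continuous' hf _ _

lemma continuous_slice_two {E : Type*} [TopologicalSpace E] {h : ℝ × ℝ × ℝ → E}
    (hh : Continuous h) (t s : ℝ) : Continuous fun z => h (t, s, z) :=
  hh.comp (by fun_prop : Continuous fun z : ℝ => (t, s, z))

lemma hasDerivAt_zInt_zero {R : ℝ} {h : ℝ × ℝ × ℝ → ℝ} (hh : ContDiff ℝ ∞ h) (t s : ℝ) :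
    HasDerivAt (fun t => zInt R h t s) (zInt R (pd e₀ h) t s) t :=
  hasDerivAt_intervalIntegral_param (F := fun t z => h (t, s, z))
    (F' := fun t z => pd e₀ h (t, s, z)) (-R) R
    (hh.continuous.comp (by fun_prop : Continuous fun q : ℝ × ℝ => (q.1, s, q.2)))
    ((contDiff_pd hh).continuous.comp (by fun_prop : Continuous fun q : ℝ × ℝ => (q.1, s, q.2)))
    (fun t z => hasDerivAt_pd_zero hh t s z) t

lemma hasDerivAt_zInt_one {R : ℝ} {h : ℝ × ℝ × ℝ → ℝ} (hh : ContDiff ℝ ∞ h) (t s : ℝ) :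
    HasDerivAt (fun s => zInt R h t s) (zInt R (pd e₁ h) t s) s :=
  hasDerivAt_intervalIntegral_param (F := fun s z => h (t, s, z))
    (F' := fun s z => pd e₁ h (t, s, z)) (-R) R
    (hh.continuous.comp (by fun_prop : Continuous fun q : ℝ × ℝ => (t, q.1, q.2)))
    ((contDiff_pd hh).continuous.comp (by fun_prop : Continuous fun q : ℝ × ℝ => (t, q.1, q.2)))
    (fun s z => hasDerivAt_pd_one hh t s z) s

lemma zInt_pd_two {R : ℝ} {h : ℝ × ℝ × ℝ → ℝ} (hh : ContDiff ℝ ∞ h) (t s : ℝ) :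
    zInt R (pd e₂ h) t s = h (t, s, R) - h (t, s, -R) :=
  integral_eq_sub_of_hasDerivAt_of_continuous
    (continuous_slice_two (contDiff_pd hh).continuous t s) (fun z => hasDerivAt_pd_two hh t s z) _ _

/-- Integrating a local conservation law over `|z| ≤ R`. -/
lemma balanceLaw_zInt {R : ℝ} {ρ q w L : ℝ × ℝ × ℝ → ℝ} (hρ : ContDiff ℝ ∞ ρ)
    (hq : ContDiff ℝ ∞ q) (hw : ContDiff ℝ ∞ w) (hL : Continuous L)
    (law : ∀ p, pd e₀ ρ p + pd e₁ q p + pd e₂ w p = L p)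
    (q_zero : ∀ t s z, |s| = |R| → q (t, s, z) = 0)
    (w_zero : ∀ t s z, |z| = |R| → w (t, s, z) = 0) :
    BalanceLaw R (zInt R ρ) (zInt R q) (zInt R L) where
  density_cont := continuous_zInt hρ.continuous
  flux_cont := continuous_zInt hq.continuous
  source_cont := continuous_zInt hL
  law := by
    refine ⟨zInt R (pd e₀ ρ), continuous_zInt (contDiff_pd hρ).continuous,
      hasDerivAt_zInt_zero hρ, fun t s => ?_⟩
    convert hasDerivAt_zInt_one hq t s using 1
    have c := fun {h : ℝ × ℝ × ℝ → ℝ} (hh : Continuous h) => continuous_slice_two hh t s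
    have e : zInt R L t s - zInt R (pd e₀ ρ) t s = zInt R (pd e₁ q) t s + zInt R (pd e₂ w) t s := by
      unfold zInt
      rw [← intervalIntegral_add_of_continuous (c (contDiff_pd hq).continuous)
        (c (contDiff_pd hw).continuous),
        ← intervalIntegral_sub_of_continuous (c hL) (c (contDiff_pd hρ).continuous)]
      congr 1; ext z
      rw [← law]; ring
    rw [e, zInt_pd_two hw, w_zero t s R rfl, w_zero t s (-R) (abs_neg R)]
    simp
  flux_left t := by simp [zInt, fun z => q_zero t (-R) z (abs_neg R)]
  flux_right t := by simp [zInt, fun z => q_zero t R z rfl]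

/-- Smooth functions vanishing near every point outside `|s| < R`, `|z| < R`. -/
structure BoxSupported (R : ℝ) (U : ℝ × ℝ × ℝ → ℂ) : Prop where
  smooth : ContDiff ℝ ∞ U
  vanish : ∀ p, (R ≤ |p.2.1| ∨ R ≤ |p.2.2|) → U =ᶠ[𝓝 p] 0

lemma BoxSupported.pd {R : ℝ} {U : ℝ × ℝ × ℝ → ℂ} (h : BoxSupported R U) (e : ℝ × ℝ × ℝ) :
    BoxSupported R (pd e U) where
  smooth := contDiff_pd h.smooth
  vanish p hp := by
    filter_upwards [(h.vanish p hp).eventuallyEq_nhds] with x hx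
    simp [_root_.pd, hx.fderiv_eq]

lemma BoxSupported.zero {R : ℝ} {U : ℝ × ℝ × ℝ → ℂ} (h : BoxSupported R U) {p : ℝ × ℝ × ℝ}
    (hp : R ≤ |p.2.1| ∨ R ≤ |p.2.2|) : U p = 0 := (h.vanish p hp).self_of_nhds

lemma BoxSupported.mass_law {R a : ℝ} (hR : 0 ≤ R) {U : ℝ × ℝ × ℝ → ℂ} (h : BoxSupported R U) :
    BalanceLaw R (zInt R (massDensity U)) (zInt R (momentumDensity a U))
      (zInt R (massSource a U)) := by
  have hU := h.smooth
  refine balanceLaw_zInt (contDiff_massDensity hU) (contDiff_momentumDensity hU) ?_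
    (contDiff_massSource hU).continuous (_root_.mass_law hU) (fun t s z hs => ?_)
    (fun t s z hz => ?_)
  · fun_prop
  · rw [abs_of_nonneg hR] at hs
    simp [momentumDensity, h.zero (p := (t, s, z)) (.inl hs.ge)]
  · rw [abs_of_nonneg hR] at hz
    simp [h.zero (p := (t, s, z)) (.inr hz.ge)]

lemma BoxSupported.momentum_law {R a : ℝ} (hR : 0 ≤ R) (ha : a * a = 1) {U : ℝ × ℝ × ℝ → ℂ}
    (h : BoxSupported R U) :
    BalanceLaw R (zInt R (momentumDensity a U)) (zInt R (momentumFlux a U))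
      (zInt R (momentumSource a U)) := by
  have hU := h.smooth
  refine balanceLaw_zInt (contDiff_momentumDensity hU) (contDiff_momentumFlux hU) ?_
    (contDiff_momentumSource hU).continuous (_root_.momentum_law hU ha) (fun t s z hs => ?_)
    (fun t s z hz => ?_)
  · fun_prop
  · rw [abs_of_nonneg hR] at hs
    simp [momentumFlux, sourcePairing, h.zero (p := (t, s, z)) (.inl hs.ge),
      (h.pd e₁).zero (p := (t, s, z)) (.inl hs.ge)]
  · rw [abs_of_nonneg hR] at hz
    simp [h.zero (p := (t, s, z)) (.inr hz.ge), (h.pd e₁).zero (p := (t, s, z)) (.inr hz.ge)]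

section bounds

lemma abs_re_mul_re_add_le (x y : ℂ) : |x.re * y.re + x.im * y.im| ≤ ‖x‖ * ‖y‖ := by
  have h := Complex.abs_re_le_norm (x * (starRingEnd ℂ) y)
  simpa using h

lemma abs_re_mul_im_sub_le (x y : ℂ) : |x.re * y.im - x.im * y.re| ≤ ‖x‖ * ‖y‖ := by
  have h := Complex.abs_im_le_norm ((starRingEnd ℂ) x * y)
  simpa [sub_eq_add_neg] using h

variable {a : ℝ} (U : ℝ × ℝ × ℝ → ℂ) (p : ℝ × ℝ × ℝ)

lemma massDensity_eq : massDensity U p = ‖U p‖ ^ 2 := by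
  rw [← Complex.normSq_eq_norm_sq, Complex.normSq_apply, massDensity]

lemma abs_momentumDensity_le (ha : |a| = 1) :
    |momentumDensity a U p| ≤ 2 * (‖U p‖ * ‖pd e₁ U p‖) := by
  rw [momentumDensity, abs_mul, abs_mul, ha]
  simpa using abs_re_mul_im_sub_le (U p) (pd e₁ U p)

lemma abs_massSource_le : |massSource a U p| ≤ 2 * (‖U p‖ * ‖waveOp a U p‖) := by
  rw [massSource, abs_mul]
  simpa using abs_re_mul_im_sub_le (U p) (waveOp a U p)

lemma abs_momentumSource_le (ha : |a| = 1) :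
    |momentumSource a U p| ≤ 4 * (‖pd e₁ U p‖ * ‖waveOp a U p‖) := by
  rw [momentumSource, abs_mul, abs_mul, ha, mul_comm ‖pd e₁ U p‖]
  simpa using abs_re_mul_re_add_le (waveOp a U p) (pd e₁ U p)

lemma abs_sourcePairing_le (ha : |a| = 1) :
    |sourcePairing a U p| ≤ 2 * (‖U p‖ * ‖waveOp a U p‖) := by
  rw [sourcePairing, abs_mul, abs_mul, ha]
  simpa using abs_re_mul_re_add_le (U p) (waveOp a U p)

lemma abs_pd_massDensity_le {U : ℝ × ℝ × ℝ → ℂ} (hU : ContDiff ℝ ∞ U) :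
    |pd e₁ (massDensity U) p| ≤ 2 * (‖U p‖ * ‖pd e₁ U p‖) := by
  rw [pd_massDensity hU, abs_mul]
  simpa using abs_re_mul_re_add_le (U p) (pd e₁ U p)

end bounds

section comparison
variable {R T c : ℝ} (hR : 0 ≤ R) {h k : ℝ × ℝ × ℝ → ℝ} (hh : Continuous h) (hk : Continuous k)
  (hle : ∀ p, |h p| ≤ c * k p)
include hR hh hk hle

lemma abs_zInt_le (t s : ℝ) : |zInt R h t s| ≤ c * zInt R k t s := by
  unfold zInt
  refine (intervalIntegral.abs_integral_le_integral_abs (by linarith)).trans ?_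
  rw [← intervalIntegral.integral_const_mul]
  exact intervalIntegral.integral_mono (by linarith)
    ((continuous_slice_two hh t s).abs.intervalIntegrable _ _)
    ((continuous_const.mul (continuous_slice_two hk t s)).intervalIntegrable _ _)
    fun z => hle _

lemma integral_abs_zInt_le (t : ℝ) :
    ∫ s in (-R)..R, |zInt R h t s| ≤ c * ∫ s in (-R)..R, zInt R k t s := by
  rw [← intervalIntegral.integral_const_mul]
  exact intervalIntegral.integral_mono (by linarith)
    (((continuous_zInt hh).uncurry_slice t).abs.intervalIntegrable _ _)
    ((continuous_const.mul ((continuous_zInt hk).uncurry_slice t)).intervalIntegrable _ _)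
    fun s => abs_zInt_le hR hh hk hle t s

lemma integral_integral_abs_zInt_le (hT : 0 ≤ T) :
    ∫ t in (-T)..T, ∫ s in (-R)..R, |zInt R h t s| ≤
      c * ∫ t in (-T)..T, ∫ s in (-R)..R, zInt R k t s := by
  rw [← intervalIntegral.integral_const_mul]
  exact intervalIntegral.integral_mono (by linarith)
    ((Continuous.uncurry_integral (f := fun t s => |zInt R h t s|)
      (continuous_zInt hh).abs _ _).intervalIntegrable _ _)
    ((continuous_const.mul ((continuous_zInt hk).uncurry_integral _ _)).intervalIntegrable _ _)
    fun t => integral_abs_zInt_le hR hh hk hle t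

end comparison

end

section
open Function Set Topology
open scoped ContDiff

/-- The bounds on a box-supported function entering the interaction estimate. -/
structure InteractionBounds (a R T A B F H : ℝ) (U : ℝ × ℝ × ℝ → ℂ) : Prop where
  mass : ∀ t, ∫ s in (-R)..R, zInt R (fun p => ‖U p‖ ^ 2) t s ≤ A
  cross : ∀ t, ∫ s in (-R)..R, zInt R (fun p => ‖U p‖ * ‖pd e₁ U p‖) t s ≤ B
  force : ∫ t in (-T)..T, ∫ s in (-R)..R, zInt R (fun p => ‖U p‖ * ‖waveOp a U p‖) t s ≤ F
  derivForce : ∫ t in (-T)..T, ∫ s in (-R)..R,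
    zInt R (fun p => ‖pd e₁ U p‖ * ‖waveOp a U p‖) t s ≤ H

/-- Integral over the two transverse variables of `|∂_s(U V̄')|²`. -/
def pairEnergy (R : ℝ) (U V : ℝ × ℝ × ℝ → ℂ) (t s : ℝ) : ℝ :=
  ∫ z in (-R)..R, ∫ z' in (-R)..R, ‖pd e₁ U (t, s, z) * (starRingEnd ℂ) (V (t, s, z')) +
    U (t, s, z) * (starRingEnd ℂ) (pd e₁ V (t, s, z'))‖ ^ 2

/-- Current density in the first direction. -/
def currentDensity (U : ℝ × ℝ × ℝ → ℂ) (p : ℝ × ℝ × ℝ) : ℝ :=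
  (U p).re * (pd e₁ U p).im - (U p).im * (pd e₁ U p).re

lemma pairEnergy_eq {R : ℝ} {U V : ℝ × ℝ × ℝ → ℂ} (hU : ContDiff ℝ ∞ U) (hV : ContDiff ℝ ∞ V)
    (t s : ℝ) : 4 * pairEnergy R U V t s =
      4 * (zInt R (massDensity (pd e₁ U)) t s * zInt R (massDensity V) t s)
      + 4 * (zInt R (massDensity U) t s * zInt R (massDensity (pd e₁ V)) t s)
      + 2 * (zInt R (pd e₁ (massDensity U)) t s * zInt R (pd e₁ (massDensity V)) t s)
      - 8 * (zInt R (currentDensity U) t s * zInt R (currentDensity V) t s) := by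
  have c1 : ∀ {W : ℝ × ℝ × ℝ → ℂ}, ContDiff ℝ ∞ W → Continuous fun z => massDensity W (t, s, z) :=
    fun hW => continuous_slice_two (contDiff_massDensity hW).continuous t s
  have c2 : ∀ {W : ℝ × ℝ × ℝ → ℂ}, ContDiff ℝ ∞ W →
      Continuous fun z => pd e₁ (massDensity W) (t, s, z) :=
    fun hW => continuous_slice_two (contDiff_pd (contDiff_massDensity hW)).continuous t s
  have c3 : ∀ {W : ℝ × ℝ × ℝ → ℂ}, ContDiff ℝ ∞ W →
      Continuous fun z => currentDensity W (t, s, z) := fun hW => by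
    refine continuous_slice_two (h := currentDensity _) ?_ t s
    exact (show ContDiff ℝ ∞ _ by unfold currentDensity; fun_prop).continuous
  have expand : ∀ z z', ‖pd e₁ U (t, s, z) * (starRingEnd ℂ) (V (t, s, z')) +
      U (t, s, z) * (starRingEnd ℂ) (pd e₁ V (t, s, z'))‖ ^ 2 =
      massDensity (pd e₁ U) (t, s, z) * massDensity V (t, s, z')
      + massDensity U (t, s, z) * massDensity (pd e₁ V) (t, s, z')
      + (1 / 2 * pd e₁ (massDensity U) (t, s, z)) * pd e₁ (massDensity V) (t, s, z')
      + (-2 * currentDensity U (t, s, z)) * currentDensity V (t, s, z') := by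
    intro z z'
    rw [← Complex.normSq_eq_norm_sq, Complex.normSq_apply, pd_massDensity hU, pd_massDensity hV]
    simp only [massDensity, currentDensity, Complex.add_re, Complex.add_im, Complex.mul_re,
      Complex.mul_im, Complex.conj_re, Complex.conj_im]
    ring
  have e1 := fun z => intervalIntegral_linear_comb (c1 hV) (c1 (contDiff_pd hV (e := e₁))) (c2 hV)
    (c3 hV) (massDensity (pd e₁ U) (t, s, z)) (massDensity U (t, s, z))
    (1 / 2 * pd e₁ (massDensity U) (t, s, z)) (-2 * currentDensity U (t, s, z)) (-R) R
  have e2 := intervalIntegral_linear_comb (c1 (contDiff_pd hU (e := e₁))) (c1 hU) (c2 hU)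
    (c3 hU) (∫ z in (-R)..R, massDensity V (t, s, z))
    (∫ z in (-R)..R, massDensity (pd e₁ V) (t, s, z))
    (1 / 2 * ∫ z in (-R)..R, pd e₁ (massDensity V) (t, s, z))
    (-2 * ∫ z in (-R)..R, currentDensity V (t, s, z)) (-R) R
  simp only [pairEnergy, expand, e1]
  simp only [zInt]
  refine (congrArg (4 * ·) (Eq.trans ?_ e2)).trans ?_
  · congr 1; ext z; ring
  · ring

section
variable {a R : ℝ} {U : ℝ × ℝ × ℝ → ℂ}

lemma zInt_momentumDensity (t s : ℝ) :
    zInt R (momentumDensity a U) t s = 2 * a * zInt R (currentDensity U) t s := by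
  simp only [zInt, momentumDensity, currentDensity, intervalIntegral.integral_const_mul]

lemma zInt_momentumFlux (hU : ContDiff ℝ ∞ U) (t s : ℝ) :
    zInt R (momentumFlux a U) t s = 4 * zInt R (massDensity (pd e₁ U)) t s
      - zInt R (pd e₁ (pd e₁ (massDensity U))) t s + zInt R (sourcePairing a U) t s := by
  have hp : ∀ p, pd e₁ (pd e₁ (massDensity U)) p =
      2 * (massDensity (pd e₁ U) p + ((U p).re * (pd e₁ (pd e₁ U) p).re +
        (U p).im * (pd e₁ (pd e₁ U) p).im)) := by
    intro p
    rw [show pd e₁ (massDensity U) = fun p =>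
      2 * ((U p).re * (pd e₁ U p).re + (U p).im * (pd e₁ U p).im) from
      funext (pd_massDensity hU e₁)]
    simp (disch := fun_prop) only [pd_add, pd_mul, pd_re, pd_im, pd_const, massDensity]
    ring
  have h := intervalIntegral_linear_comb
    (continuous_slice_two (contDiff_massDensity (contDiff_pd hU (e := e₁))).continuous t s)
    (continuous_slice_two (contDiff_pd (contDiff_pd (contDiff_massDensity hU) (e := e₁))
      (e := e₁)).continuous t s)
    (continuous_slice_two (contDiff_sourcePairing hU (a := a)).continuous t s)
    (continuous_const (y := (0 : ℝ))) 4 (-1) 1 0 (-R) R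
  simp only [zInt]
  refine (Eq.trans ?_ h).trans ?_
  · congr 1; ext z
    rw [hp]
    simp only [momentumFlux, massDensity]
    ring
  · ring

lemma abs_zInt_massDensity_le {B : ℝ} (hR : 0 ≤ R) (h : BoxSupported R U)
    (hB : ∀ t, ∫ s in (-R)..R, zInt R (fun p => ‖U p‖ * ‖pd e₁ U p‖) t s ≤ B) (t : ℝ) :
    ∀ s ∈ Icc (-R) R, |zInt R (massDensity U) t s| ≤ 2 * B := by
  intro s hs
  have hU := h.smooth
  have hc : Continuous (zInt R (pd e₁ (massDensity U)) t) :=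
    (continuous_zInt (contDiff_pd (contDiff_massDensity hU)).continuous).uncurry_slice t
  have e := integral_eq_sub_of_hasDerivAt_of_continuous hc
    (fun s => hasDerivAt_zInt_one (contDiff_massDensity hU) t s) (-R) s
  have e0 : zInt R (massDensity U) t (-R) = 0 := by
    simp [zInt, massDensity, fun z => h.zero (p := (t, -R, z)) (.inl (le_abs_self R |>.trans
      (abs_neg R).ge))]
  rw [e0, sub_zero] at e
  rw [← e]
  refine (abs_intervalIntegral_le_of_mem hc hs).trans ?_
  refine (integral_abs_zInt_le hR (contDiff_pd (contDiff_massDensity hU)).continuous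
    (k := fun p => ‖U p‖ * ‖pd e₁ U p‖)
    (hU.continuous.norm.mul (contDiff_pd hU (e := e₁)).continuous.norm)
    (fun p => abs_pd_massDensity_le p hU) t).trans ?_
  linarith [hB t]

end

/-- One half of the interaction estimate: the div-curl lemma applied to the mass law of `U` and to
the momentum law of `V`. -/
lemma mass_momentum_interaction {a R T A B F H A' B' F' H' : ℝ} (hR : 0 ≤ R) (hT : 0 ≤ T)
    (ha : |a| = 1) {U V : ℝ × ℝ × ℝ → ℂ} (hU : BoxSupported R U) (hV : BoxSupported R V)
    (bU : InteractionBounds a R T A B F H U) (bV : InteractionBounds a R T A' B' F' H' V) :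
    ∫ t in (-T)..T, ∫ s in (-R)..R, (zInt R (massDensity U) t s * zInt R (momentumFlux a V) t s -
      zInt R (momentumDensity a U) t s * zInt R (momentumDensity a V) t s) ≤
      2 * A * (2 * B') + (2 * F) * (2 * B') + A * (4 * H') := by
  have ha' : a * a = 1 := by rw [← abs_mul_abs_self, ha, one_mul]
  have sU := hU.smooth
  have sV := hV.smooth
  have nU := sU.continuous.norm
  have nV := sV.continuous.norm
  have nV' := (contDiff_pd sV (e := e₁)).continuous.norm
  have nNU := (contDiff_waveOp sU (a := a)).continuous.norm
  have nNV := (contDiff_waveOp sV (a := a)).continuous.norm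
  refine BalanceLaw.div_curl hR hT (hU.mass_law hR) (hV.momentum_law hR ha') ?_ ?_ ?_ ?_
  · intro t
    refine (integral_abs_zInt_le (c := 1) (k := fun p => ‖U p‖ ^ 2) hR
      (contDiff_massDensity sU).continuous (nU.pow 2)
      (fun p => ?_) t).trans ?_
    · rw [massDensity_eq]; simp
    · simpa using bU.mass t
  · intro t
    refine (integral_abs_zInt_le hR (contDiff_momentumDensity sV).continuous
      (k := fun p => ‖V p‖ * ‖pd e₁ V p‖) (nV.mul nV')
      (fun p => abs_momentumDensity_le V p ha) t).trans ?_
    linarith [bV.cross t]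
  · refine (integral_integral_abs_zInt_le hR (contDiff_massSource sU).continuous
      (k := fun p => ‖U p‖ * ‖waveOp a U p‖) (nU.mul nNU)
      (fun p => abs_massSource_le U p) hT).trans ?_
    linarith [bU.force]
  · refine (integral_integral_abs_zInt_le hR (contDiff_momentumSource sV).continuous
      (k := fun p => ‖pd e₁ V p‖ * ‖waveOp a V p‖) (nV'.mul nNV)
      (fun p => abs_momentumSource_le V p ha) hT).trans ?_
    linarith [bV.derivForce]

lemma integral_mass_mul_sourcePairing_le {a R T A B F H A' B' F' H' : ℝ} (hR : 0 ≤ R) (hT : 0 ≤ T)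
    (ha : |a| = 1) {U V : ℝ × ℝ × ℝ → ℂ} (hU : BoxSupported R U) (hV : BoxSupported R V)
    (bU : InteractionBounds a R T A B F H U) (bV : InteractionBounds a R T A' B' F' H' V) :
    -∫ t in (-T)..T, ∫ s in (-R)..R, zInt R (sourcePairing a V) t s * zInt R (massDensity U) t s ≤
      (2 * F') * (2 * B) := by
  have sU := hU.smooth
  have sV := hV.smooth
  have cS := continuous_zInt (R := R) (contDiff_sourcePairing sV (a := a)).continuous
  have cM := continuous_zInt (R := R) (contDiff_massDensity sU).continuous
  have hB : 0 ≤ 2 * B := (abs_nonneg _).trans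
    (abs_zInt_massDensity_le hR hU bU.cross 0 0 ⟨by linarith, hR⟩)
  have h1 := integral_integral_abs_zInt_le hR (contDiff_sourcePairing sV (a := a)).continuous
    (k := fun p => ‖V p‖ * ‖waveOp a V p‖)
    (sV.continuous.norm.mul (contDiff_waveOp sV (a := a)).continuous.norm)
      (fun p => abs_sourcePairing_le V p ha) hT
  have h2 : ∫ t in (-T)..T, ∫ s in (-R)..R, |zInt R (sourcePairing a V) t s| ≤ 2 * F' := by
    linarith [bV.force]
  refine le_trans ?_ (mul_le_mul_of_nonneg_right h2 hB)
  rw [← intervalIntegral.integral_neg, ← intervalIntegral.integral_mul_const]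
  refine intervalIntegral.integral_mono (by linarith)
    ((Continuous.uncurry_integral (f := fun t s => zInt R (sourcePairing a V) t s *
      zInt R (massDensity U) t s) (cS.mul cM) _ _).neg.intervalIntegrable _ _)
    (((Continuous.uncurry_integral (f := fun t s => |zInt R (sourcePairing a V) t s|)
      cS.abs _ _).mul continuous_const).intervalIntegrable _ _) fun t => ?_
  exact (neg_le_abs _).trans (abs_integral_mul_le_of_bound hR (cS.uncurry_slice t)
    (cM.uncurry_slice t) (abs_zInt_massDensity_le hR hU bU.cross t))

lemma continuous_pairEnergy {R : ℝ} {U V : ℝ × ℝ × ℝ → ℂ} (hU : ContDiff ℝ ∞ U)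
    (hV : ContDiff ℝ ∞ V) : Continuous (uncurry (pairEnergy R U V)) := by
  have cU := hU.continuous
  have cV := hV.continuous
  have cU' := (contDiff_pd hU (e := e₁)).continuous
  have cV' := (contDiff_pd hV (e := e₁)).continuous
  refine intervalIntegral.continuous_parametric_intervalIntegral_of_continuous'
    (f := fun (q : ℝ × ℝ) z => _) ?_ _ _
  refine intervalIntegral.continuous_parametric_intervalIntegral_of_continuous'
    (f := fun (q : (ℝ × ℝ) × ℝ) z' => _) ?_ _ _
  have hc := Complex.continuous_conj
  fun_prop

/-- The interaction estimate for box-supported functions. -/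
lemma integral_pairEnergy_le {a R T A B F H A' B' F' H' : ℝ} (hR : 0 ≤ R) (hT : 0 ≤ T)
    (ha : |a| = 1) {U V : ℝ × ℝ × ℝ → ℂ} (hU : BoxSupported R U) (hV : BoxSupported R V)
    (bU : InteractionBounds a R T A B F H U) (bV : InteractionBounds a R T A' B' F' H' V) :
    ∫ t in (-T)..T, ∫ s in (-R)..R, pairEnergy R U V t s ≤
      A * B' + A' * B + 2 * F * B' + 2 * F' * B + A * H' + A' * H := by
  have ha' : a * a = 1 := by rw [← abs_mul_abs_self, ha, one_mul]
  have sU := hU.smooth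
  have sV := hV.smooth
  have h1 := mass_momentum_interaction hR hT ha hU hV bU bV
  have h2 := mass_momentum_interaction hR hT ha hV hU bV bU
  have h3 := integral_mass_mul_sourcePairing_le hR hT ha hU hV bU bV
  have h4 := integral_mass_mul_sourcePairing_le hR hT ha hV hU bV bU
  have cM : ∀ {W : ℝ × ℝ × ℝ → ℂ}, ContDiff ℝ ∞ W → Continuous (uncurry (zInt R (massDensity W))) :=
    fun hW => continuous_zInt (contDiff_massDensity hW).continuous
  have cM' : ∀ {W : ℝ × ℝ × ℝ → ℂ}, ContDiff ℝ ∞ W →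
      Continuous (uncurry (zInt R (pd e₁ (massDensity W)))) :=
    fun hW => continuous_zInt (contDiff_pd (contDiff_massDensity hW)).continuous
  have cM'' : ∀ {W : ℝ × ℝ × ℝ → ℂ}, ContDiff ℝ ∞ W →
      Continuous (uncurry (zInt R (pd e₁ (pd e₁ (massDensity W))))) :=
    fun hW => continuous_zInt (contDiff_pd (contDiff_pd (contDiff_massDensity hW))).continuous
  have cP : ∀ {W : ℝ × ℝ × ℝ → ℂ}, ContDiff ℝ ∞ W →
      Continuous (uncurry (zInt R (momentumDensity a W))) :=
    fun hW => continuous_zInt (contDiff_momentumDensity hW).continuous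
  have cQ : ∀ {W : ℝ × ℝ × ℝ → ℂ}, ContDiff ℝ ∞ W →
      Continuous (uncurry (zInt R (momentumFlux a W))) :=
    fun hW => continuous_zInt (contDiff_momentumFlux hW).continuous
  have cS : ∀ {W : ℝ × ℝ × ℝ → ℂ}, ContDiff ℝ ∞ W →
      Continuous (uncurry (zInt R (sourcePairing a W))) :=
    fun hW => continuous_zInt (contDiff_sourcePairing hW).continuous
  have zero : ∀ {W : ℝ × ℝ × ℝ → ℂ}, BoxSupported R W → ∀ t s, |s| = |R| →
      zInt R (massDensity W) t s = 0 := by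
    intro W hW t s hs
    simp [zInt, massDensity, fun z => hW.zero (p := (t, s, z)) (.inl ((le_abs_self R).trans hs.ge))]
  have parts : ∀ {W W' : ℝ × ℝ × ℝ → ℂ}, BoxSupported R W → BoxSupported R W' → ∀ t,
      ∫ s in (-R)..R, (zInt R (pd e₁ (massDensity W)) t s * zInt R (pd e₁ (massDensity W')) t s
        + zInt R (massDensity W) t s * zInt R (pd e₁ (pd e₁ (massDensity W'))) t s) = 0 := by
    intro W W' hW hW' t
    have h := integral_eq_sub_of_hasDerivAt_of_continuous
      ((((cM' hW.smooth).uncurry_slice t).mul ((cM' hW'.smooth).uncurry_slice t)).add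
        (((cM hW.smooth).uncurry_slice t).mul ((cM'' hW'.smooth).uncurry_slice t)))
      (fun s => (hasDerivAt_zInt_one (contDiff_massDensity hW.smooth) t s).mul
        (hasDerivAt_zInt_one (contDiff_pd (contDiff_massDensity hW'.smooth)) t s)) (-R) R
    simpa [zero hW t R rfl, zero hW t (-R) (abs_neg R)] using h
  set X : (ℝ × ℝ × ℝ → ℂ) → (ℝ × ℝ × ℝ → ℂ) → ℝ → ℝ → ℝ := fun W W' t s =>
    zInt R (massDensity W) t s * zInt R (momentumFlux a W') t s -
      zInt R (momentumDensity a W) t s * zInt R (momentumDensity a W') t s with hX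
  set Y : (ℝ × ℝ × ℝ → ℂ) → (ℝ × ℝ × ℝ → ℂ) → ℝ → ℝ → ℝ := fun W W' t s =>
    zInt R (sourcePairing a W') t s * zInt R (massDensity W) t s with hY
  set Z : (ℝ × ℝ × ℝ → ℂ) → (ℝ × ℝ × ℝ → ℂ) → ℝ → ℝ → ℝ := fun W W' t s =>
    zInt R (pd e₁ (massDensity W)) t s * zInt R (pd e₁ (massDensity W')) t s
        + zInt R (massDensity W) t s * zInt R (pd e₁ (pd e₁ (massDensity W'))) t s with hZ
  have cX : ∀ {W W'}, ContDiff ℝ ∞ W → ContDiff ℝ ∞ W' → Continuous (uncurry (X W W')) :=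
    fun hW hW' => ((cM hW).mul (cQ hW')).sub ((cP hW).mul (cP hW'))
  have cY : ∀ {W W'}, ContDiff ℝ ∞ W → ContDiff ℝ ∞ W' → Continuous (uncurry (Y W W')) :=
    fun hW hW' => (cS hW').mul (cM hW)
  have cZ : ∀ {W W'}, ContDiff ℝ ∞ W → ContDiff ℝ ∞ W' → Continuous (uncurry (Z W W')) :=
    fun hW hW' => ((cM' hW).mul (cM' hW')).add ((cM hW).mul (cM'' hW'))
  have cE := continuous_pairEnergy (R := R) sU sV
  have pointwise : ∀ t s, 4 * pairEnergy R U V t s =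
      X U V t s + X V U t s - Y U V t s - Y V U t s + Z U V t s + Z V U t s := by
    intro t s
    rw [pairEnergy_eq sU sV]
    simp only [hX, hY, hZ, zInt_momentumFlux sU, zInt_momentumFlux sV, zInt_momentumDensity]
    linear_combination (8 * zInt R (currentDensity U) t s * zInt R (currentDensity V) t s) * ha'
  have inner : ∀ t, 4 * ∫ s in (-R)..R, pairEnergy R U V t s =
      1 * (∫ s in (-R)..R, X U V t s) + 1 * (∫ s in (-R)..R, X V U t s)
      + (-1) * (∫ s in (-R)..R, Y U V t s) + (-1) * ∫ s in (-R)..R, Y V U t s := by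
    intro t
    rw [← intervalIntegral_linear_comb ((cX sU sV).uncurry_slice t) ((cX sV sU).uncurry_slice t)
      ((cY sU sV).uncurry_slice t) ((cY sV sU).uncurry_slice t),
      ← intervalIntegral.integral_const_mul]
    have c0 : Continuous fun s => 1 * X U V t s + 1 * X V U t s + (-1) * Y U V t s
        + (-1) * Y V U t s := by
      have := (cX sU sV).uncurry_slice t
      have := (cX sV sU).uncurry_slice t
      have := (cY sU sV).uncurry_slice t
      have := (cY sV sU).uncurry_slice t
      fun_prop
    have e := intervalIntegral_linear_comb c0 ((cZ sU sV).uncurry_slice t)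
      ((cZ sV sU).uncurry_slice t) (continuous_const (y := (0 : ℝ))) 1 1 1 0 (-R) R
    rw [show ∫ s in (-R)..R, Z U V t s = 0 from parts hU hV t,
      show ∫ s in (-R)..R, Z V U t s = 0 from parts hV hU t] at e
    rw [show ∀ x : ℝ, 1 * x + 1 * 0 + 1 * 0 + 0 * ∫ _ in (-R)..R, (0 : ℝ) = x by simp] at e
    rw [← e]
    congr 1; ext s
    rw [pointwise]; ring
  have outer := intervalIntegral_linear_comb ((cX sU sV).uncurry_integral (-R) R)
    ((cX sV sU).uncurry_integral (-R) R) ((cY sU sV).uncurry_integral (-R) R)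
    ((cY sV sU).uncurry_integral (-R) R) 1 1 (-1) (-1) (-T) T
  simp only [← inner, intervalIntegral.integral_const_mul] at outer
  linarith

end

section
open Function Set Topology
open FourierTransform SchwartzMap
open scoped ContDiff

/-- The restriction of a Schwartz function on the plane to a horizontal line. -/
def sliceFst (g : 𝓢(ℝ × ℝ, ℂ)) (z : ℝ) : 𝓢(ℝ, ℂ) :=
  compCLMOfAntilipschitz ℂ (g := fun s : ℝ => (s, z)) (K := 1)
    (by
      have h := (ContinuousLinearMap.inl ℝ ℝ ℝ).hasTemperateGrowth.add
        (HasTemperateGrowth.const ((0, z) : ℝ × ℝ))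
      convert h using 1
      ext s <;> simp)
    (fun s s' => by simp [Prod.edist_eq]) g

@[simp]
lemma sliceFst_apply (g : 𝓢(ℝ × ℝ, ℂ)) (z s : ℝ) : sliceFst g z s = g (s, z) := rfl

/-- Exchanging the coordinates of a Schwartz function on the plane. -/
def swapCoord (g : 𝓢(ℝ × ℝ, ℂ)) : 𝓢(ℝ × ℝ, ℂ) :=
  compCLMOfContinuousLinearEquiv ℂ (ContinuousLinearEquiv.prodComm ℝ ℝ ℝ) g

lemma spatialFourier_swap (f : ℝ × ℝ → ℂ) (ξ : ℝ × ℝ) :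
    spatialFourier (fun x => f (x.2, x.1)) ξ = spatialFourier f (ξ.2, ξ.1) := by
  simp only [spatialFourier]
  rw [show (volume : Measure (ℝ × ℝ)) = volume.prod volume from rfl, ← integral_prod_swap]
  simp only [Prod.swap, add_comm]

lemma exists_bound_inv_one_add_sq (g : 𝓢(ℝ × ℝ, ℂ)) :
    ∃ C : ℝ, ∀ s z, ‖g (s, z)‖ ≤ C * (1 + s ^ 2)⁻¹ := by
  obtain ⟨C0, -, h0⟩ := g.decay 0 0
  obtain ⟨C2, -, h2⟩ := g.decay 2 0
  refine ⟨C0 + C2, fun s z => ?_⟩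
  rw [← div_eq_mul_inv, le_div_iff₀ (by positivity)]
  have h0' := h0 (s, z)
  have h2' := h2 (s, z)
  simp only [norm_iteratedFDeriv_zero, pow_zero, one_mul] at h0' h2'
  have : s ^ 2 ≤ ‖(s, z)‖ ^ 2 := by
    rw [← sq_abs, ← Real.norm_eq_abs]
    gcongr
    exact le_max_left _ _
  nlinarith [norm_nonneg (g (s, z))]

/-- If the Fourier transform of a Schwartz function on the plane vanishes along a line, so does
that of each slice at the corresponding frequency. -/
lemma fourier_sliceFst_eq_zero (g : 𝓢(ℝ × ℝ, ℂ)) {ξ : ℝ}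
    (h : ∀ η, spatialFourier g (ξ, η) = 0) (z : ℝ) : 𝓕 (sliceFst g z : ℝ → ℂ) ξ = 0 := by
  set G : ℝ × ℝ → ℂ := fun x => Complex.exp (-(2 * Real.pi * (x.1 * ξ)) * Complex.I) * g x with hG
  set F : ℝ → ℂ := fun z => 𝓕 (sliceFst g z : ℝ → ℂ) ξ with hF
  have nG : ∀ x, ‖G x‖ = ‖g x‖ := fun x => by
    rw [hG]
    simp only [norm_mul]
    rw [show -(2 * (Real.pi : ℂ) * (x.1 * ξ)) * Complex.I = (-(2 * Real.pi * (x.1 * ξ)) : ℝ) *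
      Complex.I by push_cast; ring, Complex.norm_exp_ofReal_mul_I, one_mul]
  have cG : Continuous G := by
    have := g.continuous
    rw [hG]; fun_prop
  have iG : Integrable G (volume.prod volume) :=
    (g.integrable (μ := volume)).mono cG.aestronglyMeasurable (.of_forall fun x => (nG x).le)
  have eF : F = fun z => ∫ s, G (s, z) := by
    ext z
    simp only [hF, Real.fourier_eq', hG]
    congr 1; ext s
    simp only [RCLike.inner_apply, conj_trivial, sliceFst_apply, smul_eq_mul]
    congr 2
    push_cast; ring
  have iF : Integrable F := by
    rw [eF]; exact iG.integral_prod_right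
  have cF : Continuous F := by
    obtain ⟨C, hC⟩ := exists_bound_inv_one_add_sq g
    rw [eF]
    refine continuous_of_dominated (bound := fun s => C * (1 + s ^ 2)⁻¹)
      (fun z => (cG.comp (by fun_prop : Continuous fun s : ℝ => (s, z))).aestronglyMeasurable)
      (fun z => .of_forall fun s => (nG _).trans_le (hC s z))
      (integrable_inv_one_add_sq.const_mul C)
      (.of_forall fun s => cG.comp (by fun_prop : Continuous fun z : ℝ => (s, z)))
  have tF : 𝓕 F = 0 := by
    ext η
    rw [Pi.zero_apply, ← h η, Real.fourier_eq', eF, spatialFourier]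
    rw [show (volume : Measure (ℝ × ℝ)) = volume.prod volume from rfl, integral_prod_symm]
    · congr 1; ext z
      rw [smul_eq_mul, ← integral_const_mul]
      congr 1; ext s
      simp only [hG, RCLike.inner_apply, conj_trivial]
      rw [← mul_assoc, ← Complex.exp_add]
      congr 2
      push_cast; ring
    · refine (g.integrable (μ := volume)).mono ?_ (.of_forall fun x => ?_)
      · have := g.continuous
        exact (by fun_prop : Continuous _).aestronglyMeasurable
      · rw [norm_mul, show -(2 * (Real.pi : ℂ) * (x.1 * ξ + x.2 * η)) * Complex.I =
          (-(2 * Real.pi * (x.1 * ξ + x.2 * η)) : ℝ) * Complex.I by push_cast; ring,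
          Complex.norm_exp_ofReal_mul_I, one_mul]
  have := congrFun (cF.fourierInv_fourier_eq iF (by rw [tF]; exact integrable_zero _ _ _)) z
  rw [tF] at this
  have h0 : 𝓕⁻ (0 : ℝ → ℂ) z = 0 := by simp [Real.fourierInv_eq']
  exact (h0 ▸ this).symm

end

section
open Function Set Topology
open scoped ContDiff

/-- Spatial cutoff functions, equal to one on the box of size `R`, with derivatives of size `ε`. -/
structure IsCutoff (R ε : ℝ) (χ : ℝ × ℝ × ℝ → ℂ) : Prop extends BoxSupported (3 * R) χ where
  eq_one : ∀ p : ℝ × ℝ × ℝ, |p.2.1| ≤ R → |p.2.2| ≤ R → χ p = 1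
  norm_le : ∀ p, ‖χ p‖ ≤ 1
  pd_zero : ∀ p, pd e₀ χ p = 0
  norm_pd_one : ∀ p, ‖pd e₁ χ p‖ ≤ ε
  norm_pd_two : ∀ p, ‖pd e₂ χ p‖ ≤ ε
  norm_pd_one_one : ∀ p, ‖pd e₁ (pd e₁ χ) p‖ ≤ ε
  norm_pd_two_two : ∀ p, ‖pd e₂ (pd e₂ χ) p‖ ≤ ε

section tensor
variable {A B : ℝ → ℂ} (hA : ContDiff ℝ ∞ A) (hB : ContDiff ℝ ∞ B)
include hA hB

lemma contDiff_tensor : ContDiff ℝ ∞ fun p : ℝ × ℝ × ℝ => A p.2.1 * B p.2.2 := by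
  fun_prop

lemma pd_zero_tensor (p : ℝ × ℝ × ℝ) : pd e₀ (fun p => A p.2.1 * B p.2.2) p = 0 :=
  (hasDerivAt_pd_zero (contDiff_tensor hA hB) p.1 p.2.1 p.2.2).unique
    (hasDerivAt_const p.1 (A p.2.1 * B p.2.2))

lemma pd_one_tensor :
    pd e₁ (fun p => A p.2.1 * B p.2.2) = fun p => deriv A p.2.1 * B p.2.2 := by
  ext p
  exact (hasDerivAt_pd_one (contDiff_tensor hA hB) p.1 p.2.1 p.2.2).unique
    ((hA.differentiable (by simp) p.2.1).hasDerivAt.mul_const (B p.2.2))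

lemma pd_two_tensor :
    pd e₂ (fun p => A p.2.1 * B p.2.2) = fun p => A p.2.1 * deriv B p.2.2 := by
  ext p
  exact (hasDerivAt_pd_two (contDiff_tensor hA hB) p.1 p.2.1 p.2.2).unique
    ((hB.differentiable (by simp) p.2.2).hasDerivAt.const_mul (A p.2.1))

end tensor

/-- One-dimensional cutoff functions. -/
lemma exists_cutoff_line {ε : ℝ} (hε : 0 < ε) : ∃ R₀ : ℝ, 1 ≤ R₀ ∧ ∀ R ≥ R₀, ∃ A : ℝ → ℂ,
    ContDiff ℝ ∞ A ∧ (∀ s, |s| ≤ R → A s = 1) ∧ (∀ s, 3 * R ≤ |s| → A =ᶠ[𝓝 s] 0) ∧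
    (∀ s, ‖A s‖ ≤ 1) ∧ (∀ s, ‖deriv A s‖ ≤ ε) ∧ ∀ s, ‖deriv (deriv A) s‖ ≤ ε := by
  let φ : ContDiffBump (0 : ℝ) := ⟨1, 2, by norm_num, by norm_num⟩
  let ψ : ℝ → ℂ := fun s => (φ s : ℂ)
  have sψ : ContDiff ℝ ∞ ψ := Complex.ofRealCLM.contDiff.comp φ.contDiff
  have kψ : HasCompactSupport ψ := φ.hasCompactSupport.comp_left (g := Complex.ofReal) rfl
  have sψ' : ContDiff ℝ ∞ (deriv ψ) := (contDiff_infty_iff_deriv.1 sψ).2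
  obtain ⟨c₁, h₁⟩ := kψ.deriv.exists_bound_of_continuous sψ'.continuous
  obtain ⟨c₂, h₂⟩ := kψ.deriv.deriv.exists_bound_of_continuous
    (contDiff_infty_iff_deriv.1 sψ').2.continuous
  have hc₁ : 0 ≤ c₁ := (norm_nonneg _).trans (h₁ 0)
  have hc₂ : 0 ≤ c₂ := (norm_nonneg _).trans (h₂ 0)
  refine ⟨max 1 ((c₁ + c₂) / ε), le_max_left _ _, fun R hR => ?_⟩
  have hR1 : 1 ≤ R := (le_max_left _ _).trans hR
  have hR0 : 0 < R := by linarith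
  have hcR : R⁻¹ * (c₁ + c₂) ≤ ε := by
    have := (le_max_right _ _).trans hR
    rw [div_le_iff₀ hε] at this
    rwa [inv_mul_le_iff₀ hR0]
  have hinv : R⁻¹ ≤ 1 := inv_le_one_of_one_le₀ hR1
  have d : ∀ f : ℝ → ℂ, deriv (fun s => f (R⁻¹ * s)) = fun s => (R⁻¹ : ℝ) • deriv f (R⁻¹ * s) :=
    fun f => funext fun s => deriv_comp_mul_left _ _ _
  have nR : ‖R⁻¹‖ = R⁻¹ := Real.norm_of_nonneg (by positivity)
  refine ⟨fun s => ψ (R⁻¹ * s), by fun_prop, fun s hs => ?_, fun s hs => ?_, fun s => ?_,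
    fun s => ?_, fun s => ?_⟩
  · have : φ (R⁻¹ * s) = 1 := φ.one_of_mem_closedBall (by
      rw [mem_closedBall_zero_iff, norm_mul, nR, Real.norm_eq_abs]
      change _ ≤ (1 : ℝ)
      rwa [inv_mul_le_iff₀ hR0, mul_one])
    simp [ψ, this]
  · have hs' : 2 * R < |s| := by linarith
    filter_upwards [(isOpen_lt continuous_const continuous_abs).mem_nhds hs'] with x hx
    have : φ (R⁻¹ * x) = 0 := φ.zero_of_le_dist (by
      rw [dist_zero_right, norm_mul, nR, Real.norm_eq_abs]
      change (2 : ℝ) ≤ _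
      rw [le_inv_mul_iff₀ hR0]
      linarith [show 2 * R < |x| from hx])
    simp [ψ, this]
  · simp only [ψ, Complex.norm_real, Real.norm_eq_abs, abs_of_nonneg φ.nonneg]
    exact φ.le_one
  · rw [d, norm_smul, nR]
    exact le_trans (by gcongr; linarith [h₁ (R⁻¹ * s)]) hcR
  · rw [d]
    have := d (deriv ψ)
    rw [deriv_fun_const_smul, this, norm_smul, norm_smul, nR]
    · refine le_trans ?_ hcR
      gcongr
      exact (mul_le_of_le_one_left (norm_nonneg _) hinv).trans (by linarith [h₂ (R⁻¹ * s)])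
    · exact (by fun_prop : ContDiff ℝ ∞ fun s => deriv ψ (R⁻¹ * s)).differentiable (by simp) _

lemma exists_isCutoff {ε : ℝ} (hε : 0 < ε) :
    ∃ R₀ : ℝ, 1 ≤ R₀ ∧ ∀ R ≥ R₀, ∃ χ, IsCutoff R ε χ := by
  obtain ⟨R₀, h1, h⟩ := exists_cutoff_line hε
  refine ⟨R₀, h1, fun R hR => ?_⟩
  obtain ⟨A, sA, one, van, n0, n1, n2⟩ := h R hR
  have sA' : ContDiff ℝ ∞ (deriv A) := (contDiff_infty_iff_deriv.1 sA).2
  have hm : ∀ {x y : ℂ} {c : ℝ}, ‖x‖ ≤ c → ‖y‖ ≤ 1 → ‖x * y‖ ≤ c := fun {x y c} hx hy => by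
    rw [norm_mul]
    exact (mul_le_of_le_one_right (norm_nonneg _) hy).trans hx
  have hm' : ∀ {x y : ℂ} {c : ℝ}, ‖y‖ ≤ c → ‖x‖ ≤ 1 → ‖x * y‖ ≤ c := fun hx hy => by
    rw [mul_comm]; exact hm hx hy
  refine ⟨fun p => A p.2.1 * A p.2.2,
    { smooth := contDiff_tensor sA sA
      vanish := ?_
      eq_one := fun p h h' => by simp [one _ h, one _ h']
      norm_le := fun p => hm (n0 _) (n0 _)
      pd_zero := pd_zero_tensor sA sA
      norm_pd_one := fun p => by rw [pd_one_tensor sA sA]; exact hm (n1 _) (n0 _)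
      norm_pd_two := fun p => by rw [pd_two_tensor sA sA]; exact hm' (n1 _) (n0 _)
      norm_pd_one_one := fun p => by
        rw [pd_one_tensor sA sA, pd_one_tensor sA' sA]; exact hm (n2 _) (n0 _)
      norm_pd_two_two := fun p => by
        rw [pd_two_tensor sA sA, pd_two_tensor sA sA']; exact hm' (n2 _) (n0 _) }⟩
  rintro p (hp | hp)
  · have : Filter.Tendsto (fun q : ℝ × ℝ × ℝ => q.2.1) (𝓝 p) (𝓝 p.2.1) :=
      (by fun_prop : Continuous fun q : ℝ × ℝ × ℝ => q.2.1).continuousAt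
    filter_upwards [this.eventually (van _ hp)] with q hq
    simp [hq]
  · have : Filter.Tendsto (fun q : ℝ × ℝ × ℝ => q.2.2) (𝓝 p) (𝓝 p.2.2) :=
      (by fun_prop : Continuous fun q : ℝ × ℝ × ℝ => q.2.2).continuousAt
    filter_upwards [this.eventually (van _ hp)] with q hq
    simp [hq]

/-- Localising a function with a cutoff. -/
lemma IsCutoff.boxSupported_mul {R ε : ℝ} {χ u : ℝ × ℝ × ℝ → ℂ} (h : IsCutoff R ε χ)
    (hu : ContDiff ℝ ∞ u) : BoxSupported (3 * R) fun p => χ p * u p where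
  smooth := h.smooth.mul hu
  vanish p hp := by
    filter_upwards [h.vanish p hp] with q hq
    simp [hq]

section
variable {R ε a : ℝ} {χ u : ℝ × ℝ × ℝ → ℂ} (h : IsCutoff R ε χ) (hu : ContDiff ℝ ∞ u)
  (p : ℝ × ℝ × ℝ)
include h

lemma IsCutoff.norm_mul_le : ‖χ p * u p‖ ≤ ‖u p‖ := by
  rw [norm_mul]
  exact mul_le_of_le_one_left (norm_nonneg _) (h.norm_le p)

include hu

lemma IsCutoff.norm_pd_mul_le : ‖pd e₁ (fun p => χ p * u p) p‖ ≤ ‖pd e₁ u p‖ + ε * ‖u p‖ := by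
  rw [pd_mul h.smooth hu, add_comm]
  refine (norm_add_le _ _).trans (add_le_add (h.norm_mul_le p) ?_)
  rw [norm_mul]
  gcongr
  exact h.norm_pd_one p

lemma IsCutoff.waveOp_mul : waveOp a (fun p => χ p * u p) p = χ p * waveOp a u p +
    a * (pd e₁ (pd e₁ χ) p * u p + 2 * (pd e₁ χ p * pd e₁ u p)
      - (pd e₂ (pd e₂ χ) p * u p + 2 * (pd e₂ χ p * pd e₂ u p))) := by
  have hχ := h.smooth
  have d : ∀ e, pd e (fun p => χ p * u p) = fun p => pd e χ p * u p + χ p * pd e u p :=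
    fun e => funext (pd_mul hχ hu)
  simp only [waveOp, d]
  simp (disch := fun_prop) only [pd_add, pd_mul, h.pd_zero]
  ring

lemma IsCutoff.norm_waveOp_mul_le (ha : |a| = 1) : ‖waveOp a (fun p => χ p * u p) p‖ ≤
    ‖waveOp a u p‖ + 2 * ε * (‖u p‖ + ‖pd e₁ u p‖ + ‖pd e₂ u p‖) := by
  have hm : ∀ {x y : ℂ}, ‖x‖ ≤ ε → ‖x * y‖ ≤ ε * ‖y‖ := fun hx => by
    rw [norm_mul]; gcongr
  rw [h.waveOp_mul hu]
  refine (norm_add_le _ _).trans (add_le_add (h.norm_mul_le p) ?_)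
  rw [norm_mul, Complex.norm_real, Real.norm_eq_abs, ha, one_mul]
  refine (norm_sub_le _ _).trans ?_
  have n1 := norm_add_le (pd e₁ (pd e₁ χ) p * u p) (2 * (pd e₁ χ p * pd e₁ u p))
  have n2 := norm_add_le (pd e₂ (pd e₂ χ) p * u p) (2 * (pd e₂ χ p * pd e₂ u p))
  rw [norm_mul 2, Complex.norm_ofNat] at n1 n2
  linarith [hm (y := u p) (h.norm_pd_one_one p), hm (y := u p) (h.norm_pd_two_two p),
    hm (y := pd e₁ u p) (h.norm_pd_one p), hm (y := pd e₂ u p) (h.norm_pd_two p)]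

end

end

section
open Function Set Topology
open FourierTransform SchwartzMap
open scoped ContDiff

section box

lemma ofReal_intervalIntegral {f : ℝ → ℝ} (hf : Continuous f) (h0 : ∀ x, 0 ≤ f x) {a b : ℝ}
    (hab : a ≤ b) :
    ENNReal.ofReal (∫ x in a..b, f x) = ∫⁻ x in Ioc a b, ENNReal.ofReal (f x) := by
  rw [intervalIntegral.integral_of_le hab]
  exact ofReal_integral_eq_lintegral_ofReal (hf.integrableOn_Ioc) (.of_forall h0)

lemma zInt_nonneg {R : ℝ} {k : ℝ × ℝ × ℝ → ℝ} (hR : 0 ≤ R) (h0 : ∀ p, 0 ≤ k p) (t s : ℝ) :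
    0 ≤ zInt R k t s :=
  intervalIntegral.integral_nonneg (by linarith) fun z _ => h0 _

variable {R T : ℝ} {k : ℝ × ℝ × ℝ → ℝ} (hR : 0 ≤ R) (hk : Continuous k) (h0 : ∀ p, 0 ≤ k p)
include hR hk h0

lemma ofReal_integral_zInt_le (t : ℝ) : ENNReal.ofReal (∫ s in (-R)..R, zInt R k t s) ≤
    ∫⁻ x : ℝ × ℝ, ENNReal.ofReal (k (t, x)) := by
  rw [ofReal_intervalIntegral ((continuous_zInt hk).uncurry_slice t) (zInt_nonneg hR h0 t)
    (by linarith), show (volume : Measure (ℝ × ℝ)) = volume.prod volume from rfl,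
    lintegral_prod _ (by fun_prop)]
  refine (setLIntegral_le_lintegral _ _).trans (lintegral_mono fun s => ?_)
  rw [zInt, ofReal_intervalIntegral (continuous_slice_two hk t s) (fun z => h0 _) (by linarith)]
  exact setLIntegral_le_lintegral _ _

lemma ofReal_integral_integral_zInt_le (hT : 0 ≤ T) :
    ENNReal.ofReal (∫ t in (-T)..T, ∫ s in (-R)..R, zInt R k t s) ≤
      ∫⁻ p in Ioc (-T) T ×ˢ univ, ENNReal.ofReal (k p) := by
  rw [ofReal_intervalIntegral ((continuous_zInt hk).uncurry_integral _ _)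
    (fun t => intervalIntegral.integral_nonneg (by linarith) fun s _ => zInt_nonneg hR h0 t s)
    (by linarith), show (volume : Measure (ℝ × ℝ × ℝ)) = volume.prod volume from rfl,
    ← Measure.prod_restrict, Measure.restrict_univ, lintegral_prod _ (by fun_prop)]
  exact lintegral_mono fun t => ofReal_integral_zInt_le hR hk h0 t

end box

/-- Band-limited functions with mass and interaction functional bounded by `S`. -/
structure WaveBounds (a κ S : ℝ) (u : ℝ × ℝ × ℝ → ℂ) : Prop where
  smooth : ContDiff ℝ ∞ u
  slice_one : ∀ t z, ∃ h : 𝓢(ℝ, ℂ), (∀ s, h s = u (t, s, z)) ∧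
    ∀ ξ, 𝓕 (h : ℝ → ℂ) ξ ≠ 0 → |ξ| ≤ κ
  slice_two : ∀ t s, ∃ h : 𝓢(ℝ, ℂ), (∀ z, h z = u (t, s, z)) ∧
    ∀ ξ, 𝓕 (h : ℝ → ℂ) ξ ≠ 0 → |ξ| ≤ κ
  mass : ∀ t, ∫⁻ x : ℝ × ℝ, ‖u (t, x)‖ₑ ^ 2 ≤ ENNReal.ofReal S
  force : ∀ y : ℝ × ℝ, ∫⁻ p : ℝ × ℝ × ℝ,
    ‖u (p.1, p.2.1 - y.1, p.2.2 - y.2)‖ₑ * ‖waveOp a u p‖ₑ ≤ ENNReal.ofReal S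

namespace WaveBounds
variable {a κ S : ℝ} {u : ℝ × ℝ × ℝ → ℂ} (h : WaveBounds a κ S u)
include h

lemma deriv_slice_one {f : ℝ → ℂ} {t z : ℝ} (hf : ∀ s, f s = u (t, s, z)) (s : ℝ) :
    deriv f s = pd e₁ u (t, s, z) := by
  rw [funext hf]; exact (hasDerivAt_pd_one h.smooth t s z).deriv

lemma deriv_slice_two {f : ℝ → ℂ} {t s : ℝ} (hf : ∀ z, f z = u (t, s, z)) (z : ℝ) :
    deriv f z = pd e₂ u (t, s, z) := by
  rw [funext hf]; exact (hasDerivAt_pd_two h.smooth t s z).deriv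

lemma mass_one (t : ℝ) : ∫⁻ x : ℝ × ℝ, ‖pd e₁ u (t, x)‖ₑ ^ 2 ≤
    ENNReal.ofReal ((2 * Real.pi * κ) ^ 2) * ENNReal.ofReal S := by
  have c := h.smooth.continuous
  have c' := (contDiff_pd h.smooth (e := e₁)).continuous
  refine le_trans ?_ (mul_le_mul_right (h.mass t) _)
  rw [show (volume : Measure (ℝ × ℝ)) = volume.prod volume from rfl,
    lintegral_prod_symm _ (by fun_prop), lintegral_prod_symm _ (by fun_prop),
    ← lintegral_const_mul' _ _ ofReal_ne_top]
  refine lintegral_mono fun z => ?_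
  obtain ⟨f, hf, hs⟩ := h.slice_one t z
  simpa only [hf, h.deriv_slice_one hf] using lintegral_enorm_sq_deriv_le f hs

lemma mass_two (t : ℝ) : ∫⁻ x : ℝ × ℝ, ‖pd e₂ u (t, x)‖ₑ ^ 2 ≤
    ENNReal.ofReal ((2 * Real.pi * κ) ^ 2) * ENNReal.ofReal S := by
  have c := h.smooth.continuous
  have c' := (contDiff_pd h.smooth (e := e₂)).continuous
  refine le_trans ?_ (mul_le_mul_right (h.mass t) _)
  rw [show (volume : Measure (ℝ × ℝ)) = volume.prod volume from rfl,
    lintegral_prod _ (by fun_prop), lintegral_prod _ (by fun_prop),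
    ← lintegral_const_mul' _ _ ofReal_ne_top]
  refine lintegral_mono fun s => ?_
  obtain ⟨f, hf, hs⟩ := h.slice_two t s
  simpa only [hf, h.deriv_slice_two hf] using lintegral_enorm_sq_deriv_le f hs

lemma force_one {K : 𝓢(ℝ, ℂ)}
    (hK : ∀ f : 𝓢(ℝ, ℂ), (∀ ξ, 𝓕 (f : ℝ → ℂ) ξ ≠ 0 → |ξ| ≤ κ) →
      ∀ s, ‖deriv f s‖ₑ ≤ ENNReal.ofReal κ * ∫⁻ w, ‖K w‖ₑ * ‖f (s - w / κ)‖ₑ) :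
    ∫⁻ p, ‖pd e₁ u p‖ₑ * ‖waveOp a u p‖ₑ ≤
      ENNReal.ofReal κ * ((∫⁻ w, ‖K w‖ₑ) * ENNReal.ofReal S) := by
  have c := h.smooth.continuous
  have c' := (contDiff_waveOp h.smooth (a := a)).continuous
  have cK := K.continuous
  calc ∫⁻ p, ‖pd e₁ u p‖ₑ * ‖waveOp a u p‖ₑ
      ≤ ∫⁻ p : ℝ × ℝ × ℝ, ENNReal.ofReal κ * ∫⁻ w, ‖K w‖ₑ *
          (‖u (p.1, p.2.1 - w / κ, p.2.2 - 0)‖ₑ * ‖waveOp a u p‖ₑ) := by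
        refine lintegral_mono fun ⟨t, s, z⟩ => ?_
        obtain ⟨f, hf, hs⟩ := h.slice_one t z
        have := hK f hs s
        simp only [hf, h.deriv_slice_one hf] at this
        refine (mul_le_mul_left this _).trans_eq ?_
        rw [mul_assoc, ← lintegral_mul_const _ (by fun_prop)]
        simp only [sub_zero, mul_assoc]
    _ = ENNReal.ofReal κ * ∫⁻ w, ∫⁻ p : ℝ × ℝ × ℝ, ‖K w‖ₑ *
          (‖u (p.1, p.2.1 - w / κ, p.2.2 - 0)‖ₑ * ‖waveOp a u p‖ₑ) := by
        rw [lintegral_const_mul' _ _ ofReal_ne_top, lintegral_lintegral_swap]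
        have m1 : Measurable fun q : (ℝ × ℝ × ℝ) × ℝ => ‖K q.2‖ₑ :=
          (cK.comp continuous_snd).enorm.measurable
        have m2 : Measurable fun q : (ℝ × ℝ × ℝ) × ℝ =>
            ‖u (q.1.1, q.1.2.1 - q.2 / κ, q.1.2.2 - 0)‖ₑ :=
          (c.comp (by fun_prop : Continuous fun q : (ℝ × ℝ × ℝ) × ℝ =>
            (q.1.1, q.1.2.1 - q.2 / κ, q.1.2.2 - 0))).enorm.measurable
        have m3 : Measurable fun q : (ℝ × ℝ × ℝ) × ℝ => ‖waveOp a u q.1‖ₑ :=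
          (c'.comp continuous_fst).enorm.measurable
        exact (m1.mul (m2.mul m3)).aemeasurable
    _ ≤ ENNReal.ofReal κ * ∫⁻ w, ‖K w‖ₑ * ENNReal.ofReal S := by
        gcongr with w
        rw [lintegral_const_mul' _ _ enorm_ne_top]
        gcongr
        exact h.force (w / κ, 0)
    _ = _ := by rw [lintegral_mul_const _ (by fun_prop)]

end WaveBounds

end

section
open Function Set Topology
open FourierTransform SchwartzMap
open scoped ContDiff

lemma lintegral_ofReal_add_le {α : Type*} [MeasurableSpace α] {μ : Measure α} {f g : α → ℝ}
    {c d X Y : ℝ} (hf : Measurable f) (hc : 0 ≤ c) (hd : 0 ≤ d) (hX : 0 ≤ X) (hY : 0 ≤ Y)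
    (h₁ : ∫⁻ x, ENNReal.ofReal (f x) ∂μ ≤ ENNReal.ofReal X)
    (h₂ : ∫⁻ x, ENNReal.ofReal (g x) ∂μ ≤ ENNReal.ofReal Y) :
    ∫⁻ x, ENNReal.ofReal (c * f x + d * g x) ∂μ ≤ ENNReal.ofReal (c * X + d * Y) := by
  calc ∫⁻ x, ENNReal.ofReal (c * f x + d * g x) ∂μ
      ≤ ∫⁻ x, (ENNReal.ofReal c * ENNReal.ofReal (f x)
          + ENNReal.ofReal d * ENNReal.ofReal (g x)) ∂μ := by
        refine lintegral_mono fun x => ?_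
        rw [← ENNReal.ofReal_mul hc, ← ENNReal.ofReal_mul hd]
        exact ofReal_add_le
    _ = ENNReal.ofReal c * ∫⁻ x, ENNReal.ofReal (f x) ∂μ
          + ENNReal.ofReal d * ∫⁻ x, ENNReal.ofReal (g x) ∂μ := by
        rw [lintegral_add_left (by fun_prop), lintegral_const_mul' _ _ ofReal_ne_top,
          lintegral_const_mul' _ _ ofReal_ne_top]
    _ ≤ ENNReal.ofReal c * ENNReal.ofReal X + ENNReal.ofReal d * ENNReal.ofReal Y := by gcongr
    _ = _ := by
        rw [← ENNReal.ofReal_mul hc, ← ENNReal.ofReal_mul hd,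
          ← ENNReal.ofReal_add (by positivity) (by positivity)]

namespace WaveBounds
variable {a κ S : ℝ} {u : ℝ × ℝ × ℝ → ℂ}

lemma mass_ofReal (h : WaveBounds a κ S u) (t : ℝ) :
    ∫⁻ x : ℝ × ℝ, ENNReal.ofReal (‖u (t, x)‖ ^ 2) ≤ ENNReal.ofReal S := by
  simpa [ENNReal.ofReal_pow] using h.mass t

lemma mass_one_ofReal (h : WaveBounds a κ S u) (t : ℝ) :
    ∫⁻ x : ℝ × ℝ, ENNReal.ofReal (‖pd e₁ u (t, x)‖ ^ 2) ≤
      ENNReal.ofReal ((2 * Real.pi * κ) ^ 2 * S) := by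
  rw [ENNReal.ofReal_mul (by positivity)]
  simpa only [ENNReal.ofReal_pow (norm_nonneg _), ofReal_norm] using h.mass_one t

lemma mass_two_ofReal (h : WaveBounds a κ S u) (t : ℝ) :
    ∫⁻ x : ℝ × ℝ, ENNReal.ofReal (‖pd e₂ u (t, x)‖ ^ 2) ≤
      ENNReal.ofReal ((2 * Real.pi * κ) ^ 2 * S) := by
  rw [ENNReal.ofReal_mul (by positivity)]
  simpa only [ENNReal.ofReal_pow (norm_nonneg _), ofReal_norm] using h.mass_two t

/-- The `H¹` density. -/
def energyDensity (u : ℝ × ℝ × ℝ → ℂ) (p : ℝ × ℝ × ℝ) : ℝ :=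
  ‖u p‖ ^ 2 + (‖pd e₁ u p‖ ^ 2 + ‖pd e₂ u p‖ ^ 2)

lemma energy_slab (h : WaveBounds a κ S u) (hS : 0 ≤ S) {T : ℝ} (hT : 0 ≤ T) :
    ∫⁻ p in Ioc (-T) T ×ˢ univ, ENNReal.ofReal (energyDensity u p) ≤
      ENNReal.ofReal (2 * T * ((1 + 2 * (2 * Real.pi * κ) ^ 2) * S)) := by
  have c := h.smooth.continuous
  have c₁ := (contDiff_pd h.smooth (e := e₁)).continuous
  have c₂ := (contDiff_pd h.smooth (e := e₂)).continuous
  have inner : ∀ t, ∫⁻ x : ℝ × ℝ, ENNReal.ofReal (energyDensity u (t, x)) ≤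
      ENNReal.ofReal ((1 + 2 * (2 * Real.pi * κ) ^ 2) * S) := fun t => by
    have h1 := lintegral_ofReal_add_le (c := 1) (d := 1) (by fun_prop) zero_le_one zero_le_one
      (by positivity) (by positivity) (h.mass_one_ofReal t) (h.mass_two_ofReal t)
    have h2 := lintegral_ofReal_add_le (c := 1) (d := 1) (by fun_prop) zero_le_one zero_le_one
      hS (by positivity) (h.mass_ofReal t) h1
    simp only [one_mul] at h2
    refine h2.trans_eq ?_
    congr 1; ring
  rw [show (volume : Measure (ℝ × ℝ × ℝ)) = volume.prod volume from rfl,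
    ← Measure.prod_restrict, Measure.restrict_univ, lintegral_prod _ (by
      unfold energyDensity; fun_prop)]
  refine (lintegral_mono inner).trans_eq ?_
  rw [lintegral_const, Measure.restrict_apply_univ, Real.volume_Ioc, mul_comm,
    ← ENNReal.ofReal_mul (by linarith)]
  congr 2; ring

lemma force_slab (h : WaveBounds a κ S u) (A : Set (ℝ × ℝ × ℝ)) :
    ∫⁻ p in A, ENNReal.ofReal (‖u p‖ * ‖waveOp a u p‖) ≤ ENNReal.ofReal S := by
  refine (setLIntegral_le_lintegral _ _).trans ?_
  simpa [ENNReal.ofReal_mul] using h.force 0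

/-- The cut off function satisfies the hypotheses of the interaction estimate. -/
lemma interactionBounds (h : WaveBounds a κ S u) {K : 𝓢(ℝ, ℂ)} {k T R ε : ℝ}
    {χ : ℝ × ℝ × ℝ → ℂ} (ha : |a| = 1) (hκ : 0 < κ) (hS : 0 ≤ S) (hk : 0 ≤ k)
    (hkK : ∫⁻ w, ‖K w‖ₑ ≤ ENNReal.ofReal k)
    (hK : ∀ f : 𝓢(ℝ, ℂ), (∀ ξ, 𝓕 (f : ℝ → ℂ) ξ ≠ 0 → |ξ| ≤ κ) →
      ∀ s, ‖deriv f s‖ₑ ≤ ENNReal.ofReal κ * ∫⁻ w, ‖K w‖ₑ * ‖f (s - w / κ)‖ₑ)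
    (hT : 0 ≤ T) (hR : 0 ≤ R) (hε : 0 ≤ ε) (hε1 : ε ≤ 1) (hεκ : ε ≤ κ)
    (hE1 : 6 * ε * (2 * T * (1 + 2 * (2 * Real.pi * κ) ^ 2)) ≤ 1)
    (hEκ : 6 * ε * (2 * T * (1 + 2 * (2 * Real.pi * κ) ^ 2)) ≤ κ) (hχ : IsCutoff R ε χ) :
    InteractionBounds a (3 * R) T S (24 * κ * S) (2 * S) (κ * (k + 2) * S)
      (fun p => χ p * u p) := by
  have su := h.smooth
  have sU := (hχ.boxSupported_mul su).smooth
  have c := su.continuous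
  have cN := (contDiff_waveOp su (a := a)).continuous
  have c₁ := (contDiff_pd su (e := e₁)).continuous
  have c₂ := (contDiff_pd su (e := e₂)).continuous
  have cU := sU.continuous
  have cU₁ := (contDiff_pd sU (e := e₁)).continuous
  have cNU := (contDiff_waveOp sU (a := a)).continuous
  have hR3 : 0 ≤ 3 * R := by linarith
  have nU := hχ.norm_mul_le (u := u)
  have nU₁ := hχ.norm_pd_mul_le su
  have nN := fun p => hχ.norm_waveOp_mul_le su p ha
  have energy := h.energy_slab hS hT
  have cQ : Continuous (energyDensity u) := by unfold energyDensity; fun_prop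
  refine ⟨fun t => ?_, fun t => ?_, ?_, ?_⟩
  · rw [← ENNReal.ofReal_le_ofReal_iff hS]
    refine (ofReal_integral_zInt_le hR3 (by fun_prop) (fun p => by positivity) t).trans ?_
    refine le_trans (lintegral_mono fun x => ?_) (h.mass_ofReal t)
    gcongr
    exact nU _
  · rw [← ENNReal.ofReal_le_ofReal_iff (by positivity)]
    refine (ofReal_integral_zInt_le hR3 (by fun_prop) (fun p => by positivity) t).trans ?_
    have key := lintegral_ofReal_add_le (c := 3 / 2 * κ) (d := 1 / (2 * κ)) (by fun_prop)
      (by positivity) (by positivity) hS (by positivity) (h.mass_ofReal t) (h.mass_one_ofReal t)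
    refine (lintegral_mono fun x => ENNReal.ofReal_le_ofReal ?_).trans
      (key.trans (ENNReal.ofReal_le_ofReal ?_))
    · have h1 := mul_le_mul (nU (t, x)) (nU₁ (t, x)) (norm_nonneg _) (norm_nonneg _)
      refine h1.trans ?_
      have e : 1 / (2 * κ) * ‖pd e₁ u (t, x)‖ ^ 2 + κ / 2 * ‖u (t, x)‖ ^ 2
          - ‖u (t, x)‖ * ‖pd e₁ u (t, x)‖ =
          1 / (2 * κ) * (‖pd e₁ u (t, x)‖ - κ * ‖u (t, x)‖) ^ 2 := by field_simp; ring
      have : 0 ≤ 1 / (2 * κ) * (‖pd e₁ u (t, x)‖ - κ * ‖u (t, x)‖) ^ 2 := by positivity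
      nlinarith [sq_nonneg ‖u (t, x)‖, mul_le_mul_of_nonneg_right hεκ (sq_nonneg ‖u (t, x)‖)]
    · have e : 3 / 2 * κ * S + 1 / (2 * κ) * ((2 * Real.pi * κ) ^ 2 * S) =
          (3 / 2 + 2 * Real.pi ^ 2) * (κ * S) := by field_simp
      rw [e, mul_assoc]
      gcongr
      nlinarith [Real.pi_lt_d2, Real.pi_pos]
  · rw [← ENNReal.ofReal_le_ofReal_iff (by positivity)]
    refine (ofReal_integral_integral_zInt_le hR3 (by fun_prop) (fun p => by positivity) hT).trans ?_
    have key := lintegral_ofReal_add_le (c := 1) (d := 6 * ε) (by fun_prop)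
      zero_le_one (by positivity) hS (by positivity) (h.force_slab (Ioc (-T) T ×ˢ univ)) energy
    refine (lintegral_mono fun p => ENNReal.ofReal_le_ofReal ?_).trans
      (key.trans (ENNReal.ofReal_le_ofReal ?_))
    · refine (mul_le_mul (nU p) (nN p) (norm_nonneg _) (norm_nonneg _)).trans ?_
      have : ‖u p‖ * (‖u p‖ + ‖pd e₁ u p‖ + ‖pd e₂ u p‖) ≤ 3 * energyDensity u p := by
        unfold energyDensity
        nlinarith [sq_nonneg (‖u p‖ - ‖pd e₁ u p‖), sq_nonneg (‖u p‖ - ‖pd e₂ u p‖),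
          sq_nonneg ‖u p‖, sq_nonneg ‖pd e₁ u p‖, sq_nonneg ‖pd e₂ u p‖]
      linarith [mul_le_mul_of_nonneg_left this hε]
    · nlinarith [mul_le_mul_of_nonneg_right hE1 hS]
  · rw [← ENNReal.ofReal_le_ofReal_iff (by positivity)]
    refine (ofReal_integral_integral_zInt_le hR3 (by fun_prop) (fun p => by positivity) hT).trans ?_
    have f1 : ∫⁻ p in Ioc (-T) T ×ˢ univ, ENNReal.ofReal (‖pd e₁ u p‖ * ‖waveOp a u p‖) ≤
        ENNReal.ofReal (κ * (k * S)) := by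
      refine (setLIntegral_le_lintegral _ _).trans ?_
      rw [ENNReal.ofReal_mul hκ.le, ENNReal.ofReal_mul hk]
      simp only [ENNReal.ofReal_mul (norm_nonneg _), ofReal_norm]
      refine (h.force_one hK).trans ?_
      gcongr
    have f2 := lintegral_ofReal_add_le (c := ε) (d := 6 * ε) (by fun_prop)
      hε (by positivity) hS (by positivity) (h.force_slab (Ioc (-T) T ×ˢ univ)) energy
    have key := lintegral_ofReal_add_le (c := 1) (d := 1) (by fun_prop)
      zero_le_one zero_le_one (by positivity) (by positivity) f1 f2
    refine (lintegral_mono fun p => ENNReal.ofReal_le_ofReal ?_).trans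
      (key.trans (ENNReal.ofReal_le_ofReal ?_))
    · refine (mul_le_mul (nU₁ p) (nN p) (norm_nonneg _) (by positivity)).trans ?_
      have h1 : ‖pd e₁ u p‖ + ε * ‖u p‖ ≤ ‖pd e₁ u p‖ + ‖u p‖ := by
        linarith [mul_le_of_le_one_left (norm_nonneg (u p)) hε1]
      have h2 : (‖pd e₁ u p‖ + ‖u p‖) * (‖u p‖ + ‖pd e₁ u p‖ + ‖pd e₂ u p‖) ≤
          3 * energyDensity u p := by
        unfold energyDensity
        nlinarith [sq_nonneg (‖u p‖ - ‖pd e₁ u p‖), sq_nonneg (‖u p‖ - ‖pd e₂ u p‖),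
          sq_nonneg (‖pd e₁ u p‖ - ‖pd e₂ u p‖), sq_nonneg ‖u p‖, sq_nonneg ‖pd e₁ u p‖,
          sq_nonneg ‖pd e₂ u p‖]
      have h3 := (mul_le_mul_of_nonneg_right h1 (by positivity :
        0 ≤ ‖u p‖ + ‖pd e₁ u p‖ + ‖pd e₂ u p‖)).trans h2
      have h4 := mul_le_mul_of_nonneg_left h3 hε
      linarith
    · nlinarith [mul_le_mul_of_nonneg_right hEκ hS, mul_le_mul_of_nonneg_right hεκ hS]

end WaveBounds

end

section
open Function Set Topology
open FourierTransform SchwartzMap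
open scoped ContDiff

/-- The derivative in `s` of `U(t,s,z)` times the conjugate of `V(t,s,z')`. -/
def pairDeriv (U V : ℝ × ℝ × ℝ → ℂ) (q : ℝ × ℝ × ℝ × ℝ) : ℂ :=
  pd e₁ U (q.1, q.2.1, q.2.2.1) * (starRingEnd ℂ) (V (q.1, q.2.1, q.2.2.2)) +
    U (q.1, q.2.1, q.2.2.1) * (starRingEnd ℂ) (pd e₁ V (q.1, q.2.1, q.2.2.2))

lemma continuous_pairDeriv {U V : ℝ × ℝ × ℝ → ℂ} (hU : ContDiff ℝ ∞ U) (hV : ContDiff ℝ ∞ V) :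
    Continuous (pairDeriv U V) := by
  have cU := hU.continuous
  have cV := hV.continuous
  have cU' := (contDiff_pd hU (e := e₁)).continuous
  have cV' := (contDiff_pd hV (e := e₁)).continuous
  have hc := Complex.continuous_conj
  unfold pairDeriv
  fun_prop

/-- The box `|t| ≤ T`, `|s|, |z|, |z'| ≤ R`. -/
def pairBox (T R : ℝ) : Set (ℝ × ℝ × ℝ × ℝ) :=
  Ioc (-T) T ×ˢ Ioc (-R) R ×ˢ Ioc (-R) R ×ˢ Ioc (-R) R

lemma setLIntegral_prod_set {α β : Type*} [MeasureSpace α] [MeasureSpace β]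
    [SFinite (volume : Measure α)] [SFinite (volume : Measure β)] (A : Set α) (B : Set β)
    {f : α × β → ℝ≥0∞} (hf : Measurable f) :
    ∫⁻ x in A ×ˢ B, f x = ∫⁻ x in A, ∫⁻ y in B, f (x, y) := by
  rw [show (volume : Measure (α × β)) = volume.prod volume from rfl, ← Measure.prod_restrict,
    lintegral_prod _ hf.aemeasurable]

lemma ofReal_integral_pairEnergy {R T : ℝ} (hR : 0 ≤ R) (hT : 0 ≤ T) {U V : ℝ × ℝ × ℝ → ℂ}
    (hU : ContDiff ℝ ∞ U) (hV : ContDiff ℝ ∞ V) :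
    ENNReal.ofReal (∫ t in (-T)..T, ∫ s in (-R)..R, pairEnergy R U V t s) =
      ∫⁻ q in pairBox T R, ‖pairDeriv U V q‖ₑ ^ 2 := by
  have hR' : -R ≤ R := by linarith
  have cE := continuous_pairEnergy (R := R) hU hV
  have cP := continuous_pairDeriv hU hV
  have cI : ∀ t s, Continuous fun z => ∫ z' in (-R)..R, ‖pairDeriv U V (t, s, z, z')‖ ^ 2 :=
    fun t s => Continuous.uncurry_integral (f := fun z z' => ‖pairDeriv U V (t, s, z, z')‖ ^ 2)
      (by unfold uncurry; fun_prop) _ _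
  have eE : ∀ t s, pairEnergy R U V t s =
    ∫ z in (-R)..R, ∫ z' in (-R)..R, ‖pairDeriv U V (t, s, z, z')‖ ^ 2 := fun t s => rfl
  have nI : ∀ t s z, 0 ≤ ∫ z' in (-R)..R, ‖pairDeriv U V (t, s, z, z')‖ ^ 2 := fun t s z =>
    intervalIntegral.integral_nonneg hR' fun _ _ => by positivity
  have nE : ∀ t s, 0 ≤ pairEnergy R U V t s := fun t s =>
    intervalIntegral.integral_nonneg hR' fun z _ => nI t s z
  have mP : Measurable fun q => ‖pairDeriv U V q‖ₑ ^ 2 := cP.enorm.measurable.pow_const 2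
  rw [ofReal_intervalIntegral (cE.uncurry_integral _ _)
    (fun t => intervalIntegral.integral_nonneg hR' fun s _ => nE t s) (by linarith), pairBox,
    setLIntegral_prod_set _ _ mP]
  refine lintegral_congr fun t => ?_
  rw [ofReal_intervalIntegral (cE.uncurry_slice t) (nE t) hR',
    setLIntegral_prod_set _ _ (f := fun x => ‖pairDeriv U V (t, x)‖ₑ ^ 2)
      (mP.comp measurable_prodMk_left)]
  refine lintegral_congr fun s => ?_
  rw [eE, ofReal_intervalIntegral (cI t s) (nI t s) hR',
    setLIntegral_prod_set _ _ (f := fun x => ‖pairDeriv U V (t, s, x)‖ₑ ^ 2)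
      (mP.comp (measurable_prodMk_left.comp measurable_prodMk_left))]
  refine lintegral_congr fun z => ?_
  rw [ofReal_intervalIntegral _ (fun z' => by positivity) hR']
  · refine lintegral_congr fun z' => ?_
    rw [ENNReal.ofReal_pow (norm_nonneg _), ofReal_norm]
  · fun_prop

lemma iUnion_pairBox : ⋃ n : ℕ, pairBox n n = univ := by
  refine eq_univ_of_forall fun q => mem_iUnion.2 ?_
  obtain ⟨n, hn⟩ := exists_nat_gt (|q.1| + |q.2.1| + |q.2.2.1| + |q.2.2.2|)
  have := abs_nonneg q.1
  have := abs_nonneg q.2.1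
  have := abs_nonneg q.2.2.1
  have := abs_nonneg q.2.2.2
  have key : ∀ {x : ℝ}, |x| < n → x ∈ Ioc (-n : ℝ) n := fun hx =>
    ⟨(abs_lt.1 hx).1, (abs_lt.1 hx).2.le⟩
  exact ⟨n, key (by linarith), key (by linarith), key (by linarith), key (by linarith)⟩

lemma pairBox_mono {T T' R R' : ℝ} (hT : T ≤ T') (hR : R ≤ R') : pairBox T R ⊆ pairBox T' R' := by
  have h1 : Ioc (-T) T ⊆ Ioc (-T') T' := Ioc_subset_Ioc (by linarith) hT
  have h2 : Ioc (-R) R ⊆ Ioc (-R') R' := Ioc_subset_Ioc (by linarith) hR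
  exact prod_mono h1 (prod_mono h2 (prod_mono h2 h2))

lemma lintegral_le_of_pairBox {f : ℝ × ℝ × ℝ × ℝ → ℝ≥0∞} {M : ℝ≥0∞}
    (h : ∀ n : ℕ, ∫⁻ q in pairBox n n, f q ≤ M) : ∫⁻ q, f q ≤ M := by
  have hm : Monotone fun n : ℕ => pairBox n n := fun n m hnm =>
    pairBox_mono (by exact_mod_cast hnm) (by exact_mod_cast hnm)
  rw [← setLIntegral_univ, ← iUnion_pairBox, setLIntegral_iUnion_of_directed _ hm.directed_le]
  exact iSup_le h

lemma IsCutoff.mul_eventuallyEq {R ε : ℝ} {χ u : ℝ × ℝ × ℝ → ℂ} (h : IsCutoff R ε χ)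
    {p : ℝ × ℝ × ℝ} (h₁ : |p.2.1| < R) (h₂ : |p.2.2| < R) : (fun p => χ p * u p) =ᶠ[𝓝 p] u := by
  have o₁ : IsOpen {p : ℝ × ℝ × ℝ | |p.2.1| < R} := isOpen_lt (by fun_prop) continuous_const
  have o₂ : IsOpen {p : ℝ × ℝ × ℝ | |p.2.2| < R} := isOpen_lt (by fun_prop) continuous_const
  filter_upwards [o₁.mem_nhds h₁, o₂.mem_nhds h₂] with q hq₁ hq₂
  rw [h.eq_one q (le_of_lt hq₁) (le_of_lt hq₂), one_mul]

lemma IsCutoff.pairDeriv_eq {R ε : ℝ} {χ u v : ℝ × ℝ × ℝ → ℂ} (h : IsCutoff R ε χ)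
    {q : ℝ × ℝ × ℝ × ℝ} (h₁ : |q.2.1| < R) (h₂ : |q.2.2.1| < R) (h₃ : |q.2.2.2| < R) :
    pairDeriv (fun p => χ p * u p) (fun p => χ p * v p) q = pairDeriv u v q := by
  have eu := h.mul_eventuallyEq (u := u) (p := (q.1, q.2.1, q.2.2.1)) h₁ h₂
  have ev := h.mul_eventuallyEq (u := v) (p := (q.1, q.2.1, q.2.2.2)) h₁ h₃
  have hu : χ (q.1, q.2.1, q.2.2.1) * u (q.1, q.2.1, q.2.2.1) = u (q.1, q.2.1, q.2.2.1) :=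
    eu.self_of_nhds
  have hv : χ (q.1, q.2.1, q.2.2.2) * v (q.1, q.2.1, q.2.2.2) = v (q.1, q.2.1, q.2.2.2) :=
    ev.self_of_nhds
  simp only [pairDeriv, pd]
  rw [eu.fderiv_eq, ev.fderiv_eq, hu, hv]

/-- The bilinear interaction estimate for band-limited functions. -/
lemma exists_lintegral_pairDeriv_le : ∃ C : ℝ, 0 < C ∧ ∀ {a κ S S' : ℝ} {u v : ℝ × ℝ × ℝ → ℂ},
    |a| = 1 → 0 < κ → 0 ≤ S → 0 ≤ S' → WaveBounds a κ S u → WaveBounds a κ S' v →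
    ∫⁻ q, ‖pairDeriv u v q‖ₑ ^ 2 ≤ ENNReal.ofReal (C * κ * S * S') := by
  obtain ⟨K, hK⟩ := exists_deriv_kernel
  set k : ℝ := ∫ w, ‖K w‖ with hk_def
  have hk : 0 ≤ k := integral_nonneg fun w => norm_nonneg _
  have hkK : ∫⁻ w, ‖K w‖ₑ ≤ ENNReal.ofReal k := by
    rw [hk_def, ofReal_integral_norm_eq_lintegral_enorm K.integrable]
  refine ⟨244 + 2 * k, by positivity, fun {a κ S S' u v} ha hκ hS hS' hu hv => ?_⟩
  refine lintegral_le_of_pairBox fun n => ?_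
  have hT : (0 : ℝ) ≤ n := n.cast_nonneg
  set E : ℝ := 2 * n * (1 + 2 * (2 * Real.pi * κ) ^ 2) with hE
  have hE0 : 0 ≤ E := by positivity
  obtain ⟨ε, hε, hεm⟩ : ∃ ε : ℝ, 0 < ε ∧ ε * (1 + 6 * E) ≤ min 1 κ :=
    ⟨min 1 κ / (1 + 6 * E), by positivity, (div_mul_cancel₀ _ (by positivity)).le⟩
  have hεE : 0 ≤ ε * (6 * E) := by positivity
  have hm1 := min_le_left 1 κ
  have hmκ := min_le_right 1 κ
  obtain ⟨R₀, hR₀, hcut⟩ := exists_isCutoff hε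
  set R : ℝ := max R₀ (n + 1) with hRdef
  obtain ⟨χ, hχ⟩ := hcut R (le_max_left _ _)
  have hR : 0 ≤ R := by linarith [le_max_left R₀ (n + 1 : ℝ)]
  have hRn : (n : ℝ) < R := by linarith [le_max_right R₀ (n + 1 : ℝ)]
  have bu := hu.interactionBounds ha hκ hS hk hkK (hK κ hκ) hT hR hε.le (by linarith) (by linarith)
    (by linarith) (by linarith) hχ
  have bv := hv.interactionBounds ha hκ hS' hk hkK (hK κ hκ) hT hR hε.le (by linarith)
    (by linarith) (by linarith) (by linarith) hχ
  have sU := hχ.boxSupported_mul hu.smooth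
  have sV := hχ.boxSupported_mul hv.smooth
  have main := integral_pairEnergy_le (by linarith) hT ha sU sV bu bv
  have eq : ∀ q ∈ pairBox n n, ‖pairDeriv u v q‖ₑ ^ 2 =
      ‖pairDeriv (fun p => χ p * u p) (fun p => χ p * v p) q‖ₑ ^ 2 := by
    intro q hq
    obtain ⟨-, h₁, h₂, h₃⟩ := hq
    have key : ∀ {x : ℝ}, x ∈ Ioc (-n : ℝ) n → |x| < R := fun hx =>
      (abs_le.2 ⟨hx.1.le, hx.2⟩).trans_lt hRn
    rw [hχ.pairDeriv_eq (key h₁) (key h₂) (key h₃)]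
  have meas : MeasurableSet (pairBox n n) :=
    measurableSet_Ioc.prod (measurableSet_Ioc.prod (measurableSet_Ioc.prod measurableSet_Ioc))
  rw [setLIntegral_congr_fun meas eq]
  refine (lintegral_mono_set (pairBox_mono (T' := n) (R' := 3 * R) le_rfl (by linarith))).trans ?_
  rw [← ofReal_integral_pairEnergy (by linarith) hT sU.smooth sV.smooth]
  refine ENNReal.ofReal_le_ofReal (main.trans_eq ?_)
  ring

end

section
open Function Set Topology
open FourierTransform SchwartzMap
open scoped ContDiff

/-- Translation in the spatial variables. -/
def translateSpace (y : ℝ × ℝ) (u : ℝ × ℝ × ℝ → ℂ) (p : ℝ × ℝ × ℝ) : ℂ :=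
  u (p.1, p.2.1 - y.1, p.2.2 - y.2)

/-- Exchanging the two spatial variables. -/
def swapSpace {E : Type*} (u : ℝ × ℝ × ℝ → E) (p : ℝ × ℝ × ℝ) : E :=
  u (p.1, p.2.2, p.2.1)

lemma translateSpace_eq (y : ℝ × ℝ) (u : ℝ × ℝ × ℝ → ℂ) :
    translateSpace y u = fun p => u (p - (0, y)) := by
  ext p
  simp [translateSpace, Prod.sub_def]

lemma pd_comp_sub (e w : ℝ × ℝ × ℝ) (u : ℝ × ℝ × ℝ → ℂ) :
    pd e (fun p => u (p - w)) = fun p => pd e u (p - w) := by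
  ext p
  simp only [pd]
  rw [fderiv_comp_sub]

lemma waveOp_translateSpace (a : ℝ) (y : ℝ × ℝ) (u : ℝ × ℝ × ℝ → ℂ) :
    waveOp a (translateSpace y u) = translateSpace y (waveOp a u) := by
  rw [translateSpace_eq, translateSpace_eq]
  ext p
  simp only [waveOp, pd_comp_sub]

lemma pd_swapSpace (e : ℝ × ℝ × ℝ) {u : ℝ × ℝ × ℝ → ℂ} (hu : ContDiff ℝ ∞ u) :
    pd e (swapSpace u) = swapSpace (pd (e.1, e.2.2, e.2.1) u) := by
  ext p
  set L : ℝ × ℝ × ℝ →L[ℝ] ℝ × ℝ × ℝ := (ContinuousLinearMap.fst ℝ ℝ (ℝ × ℝ)).prod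
    (((ContinuousLinearMap.snd ℝ ℝ ℝ).prod (ContinuousLinearMap.fst ℝ ℝ ℝ)).comp
      (ContinuousLinearMap.snd ℝ ℝ (ℝ × ℝ)))
  have h : HasFDerivAt (swapSpace u) ((fderiv ℝ u (L p)).comp L) p :=
    ((hu.differentiable (by simp)) (L p)).hasFDerivAt.comp p L.hasFDerivAt
  simp only [pd, h.fderiv]
  rfl

lemma ContDiff.swapSpace {u : ℝ × ℝ × ℝ → ℂ} (hu : ContDiff ℝ ∞ u) :
    ContDiff ℝ ∞ (swapSpace u) := by
  unfold _root_.swapSpace; fun_prop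

lemma waveOp_swapSpace (a : ℝ) {u : ℝ × ℝ × ℝ → ℂ} (hu : ContDiff ℝ ∞ u) :
    waveOp a (swapSpace u) = swapSpace (waveOp (-a) u) := by
  ext p
  simp only [waveOp, pd_swapSpace _ hu, pd_swapSpace _ (contDiff_pd hu), swapSpace]
  push_cast
  ring

lemma hypSchrod_eq_waveOp (u : ℝ × ℝ × ℝ → ℂ) : hypSchrod u = waveOp 1 u := by
  ext p
  simp only [hypSchrod, waveOp, pd, Complex.ofReal_one, one_mul]
  exact add_sub_assoc _ _ _

lemma lintegral_swapSpace {f : ℝ × ℝ × ℝ → ℝ≥0∞} :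
    ∫⁻ p, swapSpace f p = ∫⁻ p, f p := by
  have h : MeasurePreserving (Prod.map id Prod.swap : ℝ × ℝ × ℝ → ℝ × ℝ × ℝ) :=
    (MeasurePreserving.id volume).prod Measure.measurePreserving_swap
  exact h.lintegral_comp_emb ((MeasurableEquiv.refl ℝ).prodCongr
    MeasurableEquiv.prodComm).measurableEmbedding f

lemma LinfL2_swapSpace (u : ℝ × ℝ × ℝ → ℂ) : LinfL2 (swapSpace u) = LinfL2 u := by
  unfold LinfL2
  congr! 3 with t
  exact lintegral_prod_swap (μ := volume) (ν := volume)
    fun x : ℝ × ℝ => (‖u (t, x.1, x.2)‖₊ : ℝ≥0∞) ^ 2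

lemma interact_swapSpace (u N : ℝ × ℝ × ℝ → ℂ) :
    interact (swapSpace u) (swapSpace N) = interact u N := by
  unfold interact
  refine (Equiv.prodComm ℝ ℝ).iSup_congr fun y => ?_
  exact (lintegral_swapSpace (f := fun p : ℝ × ℝ × ℝ =>
    (‖u (p.1, p.2.1 - y.2, p.2.2 - y.1)‖₊ : ℝ≥0∞) * (‖N p‖₊ : ℝ≥0∞))).symm

/-- A Schwartz function of one variable with Fourier support in `{P}`. -/
def IsBand (P : ℝ → Prop) (f : ℝ → ℂ) : Prop :=
  ∃ h : 𝓢(ℝ, ℂ), (∀ s, h s = f s) ∧ ∀ ξ, 𝓕 (h : ℝ → ℂ) ξ ≠ 0 → P ξ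

lemma IsBand.comp_sub {P : ℝ → Prop} {f : ℝ → ℂ} (hf : IsBand P f) (y : ℝ) :
    IsBand P fun s => f (s - y) := by
  obtain ⟨h, e, hP⟩ := hf
  refine ⟨compSubConstCLM ℂ y h, fun s => by simp [e], fun ξ hξ => hP ξ ?_⟩
  contrapose! hξ
  have := congrFun (VectorFourier.fourierIntegral_comp_add_right Real.fourierChar volume
    (innerₗ ℝ) (h : ℝ → ℂ) (-y)) ξ
  have e2 : (compSubConstCLM ℂ y h : ℝ → ℂ) = (h : ℝ → ℂ) ∘ fun s => s + -y := by
    ext s; simp [sub_eq_add_neg]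
  rw [e2]
  refine this.trans ?_
  change _ • 𝓕 (h : ℝ → ℂ) ξ = 0
  rw [hξ, smul_zero]

lemma IsBand.mono {P Q : ℝ → Prop} {f : ℝ → ℂ} (hf : IsBand P f) (h : ∀ ξ, P ξ → Q ξ) :
    IsBand Q f := by
  obtain ⟨k, e, hP⟩ := hf
  exact ⟨k, e, fun ξ hξ => h ξ (hP ξ hξ)⟩

/-- A smooth function, Schwartz in space, with spatial Fourier support in `{P}`. -/
structure SpaceBand (P : ℝ × ℝ → Prop) (u : ℝ × ℝ × ℝ → ℂ) : Prop where
  smooth : ContDiff ℝ ∞ u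
  schwartz : ∀ t, ∃ g : 𝓢(ℝ × ℝ, ℂ), ∀ x : ℝ × ℝ, g x = u (t, x)
  support : ∀ t ξ, spatialFourier (fun x => u (t, x)) ξ ≠ 0 → P ξ

namespace SpaceBand
variable {P : ℝ × ℝ → Prop} {u : ℝ × ℝ × ℝ → ℂ}

lemma swapSpace (h : SpaceBand P u) : SpaceBand (fun ξ => P (ξ.2, ξ.1)) (swapSpace u) where
  smooth := h.smooth.swapSpace
  schwartz t := by
    obtain ⟨g, hg⟩ := h.schwartz t
    exact ⟨swapCoord g, fun x => hg _⟩
  support t ξ hξ := by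
    refine h.support t _ ?_
    rwa [← spatialFourier_swap]

lemma slice_one (h : SpaceBand P u) (t z : ℝ) :
    IsBand (fun ξ => ∃ η, P (ξ, η)) fun s => u (t, s, z) := by
  obtain ⟨g, hg⟩ := h.schwartz t
  refine ⟨sliceFst g z, fun s => hg _, fun ξ hξ => ?_⟩
  contrapose! hξ
  refine fourier_sliceFst_eq_zero g (fun η => ?_) z
  by_contra hne
  rw [funext hg] at hne
  exact hξ η (h.support t _ hne)

lemma slice_two (h : SpaceBand P u) (t s : ℝ) :
    IsBand (fun ξ => ∃ η, P (η, ξ)) fun z => u (t, s, z) :=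
  h.swapSpace.slice_one t s

end SpaceBand

/-- The quantity controlling a solution: its mass and its interaction with the forcing. -/
def energyBound (a : ℝ) (u : ℝ × ℝ × ℝ → ℂ) : ℝ≥0∞ :=
  LinfL2 u + interact u (waveOp a u) ^ (1 / 2 : ℝ)

lemma lintegral_le_LinfL2_sq (u : ℝ × ℝ × ℝ → ℂ) (t : ℝ) :
    ∫⁻ x : ℝ × ℝ, ‖u (t, x)‖ₑ ^ 2 ≤ LinfL2 u ^ 2 := by
  have h : (∫⁻ x : ℝ × ℝ, ‖u (t, x)‖ₑ ^ 2) ^ (1 / 2 : ℝ) ≤ LinfL2 u :=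
    le_iSup (fun t : ℝ => (∫⁻ x : ℝ × ℝ, (‖u (t, x.1, x.2)‖₊ : ℝ≥0∞) ^ 2) ^ (1 / 2 : ℝ)) t
  rw [one_div, ENNReal.rpow_inv_le_iff (by norm_num)] at h
  exact_mod_cast h

lemma eq_zero_of_LinfL2_eq_zero {u : ℝ × ℝ × ℝ → ℂ} (hu : Continuous u) (h : LinfL2 u = 0) :
    u = 0 := by
  ext ⟨t, x⟩
  have h0 := lintegral_le_LinfL2_sq u t
  have c : Continuous fun x : ℝ × ℝ => ‖u (t, x)‖ₑ ^ 2 := by fun_prop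
  rw [h, zero_pow two_ne_zero, nonpos_iff_eq_zero, lintegral_eq_zero_iff c.measurable] at h0
  have := congrFun ((c.ae_eq_iff_eq volume continuous_zero).1 h0) x
  simpa using this

lemma SpaceBand.waveBounds {P : ℝ × ℝ → Prop} {u : ℝ × ℝ × ℝ → ℂ} {a κ : ℝ} (h : SpaceBand P u)
    (hP : ∀ ξ, P ξ → |ξ.1| ≤ κ ∧ |ξ.2| ≤ κ) (hA : energyBound a u ≠ ⊤) :
    WaveBounds a κ (energyBound a u ^ 2).toReal u where
  smooth := h.smooth
  slice_one t z := (h.slice_one t z).mono fun ξ ⟨η, hη⟩ => (hP _ hη).1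
  slice_two t s := (h.slice_two t s).mono fun ξ ⟨η, hη⟩ => (hP _ hη).2
  mass t := by
    rw [ofReal_toReal (by finiteness)]
    refine (lintegral_le_LinfL2_sq u t).trans ?_
    gcongr
    exact le_self_add
  force y := by
    rw [ofReal_toReal (by finiteness)]
    refine (le_iSup (fun y : ℝ × ℝ => ∫⁻ p : ℝ × ℝ × ℝ,
      ‖u (p.1, p.2.1 - y.1, p.2.2 - y.2)‖ₑ * ‖waveOp a u p‖ₑ) y).trans ?_
    change interact u (waveOp a u) ≤ _
    have : interact u (waveOp a u) ^ (1 / 2 : ℝ) ≤ energyBound a u := le_add_self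
    rw [one_div, ENNReal.rpow_inv_le_iff (by norm_num)] at this
    exact_mod_cast this

lemma WaveBounds.translateSpace {a κ S : ℝ} {u : ℝ × ℝ × ℝ → ℂ} (h : WaveBounds a κ S u)
    (y : ℝ × ℝ) : WaveBounds a κ S (_root_.translateSpace y u) where
  smooth := by
    have := h.smooth
    unfold _root_.translateSpace; fun_prop
  slice_one t z := IsBand.comp_sub (h.slice_one t (z - y.2)) y.1
  slice_two t s := IsBand.comp_sub (h.slice_two t (s - y.1)) y.2
  mass t := (lintegral_sub_right_eq_self (fun x : ℝ × ℝ => ‖u (t, x)‖ₑ ^ 2) y).trans_le (h.mass t)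
  force w := by
    refine le_of_eq_of_le ?_ (h.force w)
    have : (volume : Measure (ℝ × ℝ × ℝ)).IsAddRightInvariant :=
      inferInstanceAs ((volume : Measure ℝ).prod (volume : Measure (ℝ × ℝ))).IsAddRightInvariant
    rw [waveOp_translateSpace]
    refine Eq.trans (lintegral_congr fun p => ?_) (lintegral_sub_right_eq_self (fun p =>
      ‖u (p.1, p.2.1 - w.1, p.2.2 - w.2)‖ₑ * ‖waveOp a u p‖ₑ) ((0, y) : ℝ × ℝ × ℝ))
    rw [translateSpace_eq, translateSpace_eq]
    change ‖u (p.1 - 0, p.2.1 - w.1 - y.1, p.2.2 - w.2 - y.2)‖ₑ * _ =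
      ‖u (p.1 - 0, p.2.1 - y.1 - w.1, p.2.2 - y.2 - w.2)‖ₑ * _
    rw [sub_right_comm p.2.1, sub_right_comm p.2.2]

/-- The square of the bilinear mixed norm. -/
def mixedSq (u v : ℝ × ℝ × ℝ → ℂ) : ℝ≥0∞ :=
  ∫⁻ t : ℝ, ∫⁻ s : ℝ, (∫⁻ z : ℝ, ‖u (t, s, z)‖ₑ ^ 2) * ∫⁻ z : ℝ, ‖v (t, s, z)‖ₑ ^ 2

lemma le_lintegral_pairDeriv_slice {u v : ℝ × ℝ × ℝ → ℂ} (hu : ContDiff ℝ ∞ u)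
    (hv : ContDiff ℝ ∞ v) {κ ρ : ℝ} (hκ : κ ≤ ρ) {t z z' : ℝ}
    (bu : IsBand (fun ξ => |ξ| ≤ κ) fun s => u (t, s, z))
    (bv : IsBand (fun ξ => ρ ≤ |ξ|) fun s => v (t, s, z')) :
    ENNReal.ofReal ((2 * Real.pi * (ρ - κ)) ^ 2) *
      ∫⁻ s, ‖u (t, s, z)‖ₑ ^ 2 * ‖v (t, s, z')‖ₑ ^ 2 ≤
      ∫⁻ s, ‖pairDeriv u v (t, s, z, z')‖ₑ ^ 2 := by
  obtain ⟨h, eh, sh⟩ := bu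
  obtain ⟨k, ek, sk⟩ := bv
  have e : ∀ s, mulConj h k s = u (t, s, z) * (starRingEnd ℂ) (v (t, s, z')) := fun s => by
    rw [mulConj_apply, eh, ek]
  have d : ∀ s, deriv (mulConj h k) s = pairDeriv u v (t, s, z, z') := fun s => by
    rw [funext e]
    exact ((hasDerivAt_pd_one hu t s z).mul (hasDerivAt_pd_one hv t s z').star).deriv
  have main := le_lintegral_enorm_sq_deriv (mulConj h k) (sub_nonneg.2 hκ)
    (fourier_mulConj_support h k sh sk)
  simpa only [d, e, enorm_mul, RCLike.enorm_conj, mul_pow ‖_‖ₑ] using main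

lemma lintegral_rotate {f : ℝ × ℝ × ℝ × ℝ → ℝ≥0∞} (hf : Measurable f) :
    ∫⁻ q, f q = ∫⁻ t, ∫⁻ z, ∫⁻ z', ∫⁻ s, f (t, s, z, z') := by
  rw [show (volume : Measure (ℝ × ℝ × ℝ × ℝ)) = volume.prod volume from rfl,
    lintegral_prod _ hf.aemeasurable]
  refine lintegral_congr fun t => ?_
  rw [show (volume : Measure (ℝ × ℝ × ℝ)) = volume.prod volume from rfl,
    lintegral_prod_symm _ (by fun_prop),
    show (volume : Measure (ℝ × ℝ)) = volume.prod volume from rfl, lintegral_prod _ ?_]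
  exact (Measurable.lintegral_prod_left (by fun_prop)).aemeasurable

lemma mixedSq_eq {u v : ℝ × ℝ × ℝ → ℂ} (hu : Continuous u) (hv : Continuous v) :
    mixedSq u v = ∫⁻ q : ℝ × ℝ × ℝ × ℝ,
      ‖u (q.1, q.2.1, q.2.2.1)‖ₑ ^ 2 * ‖v (q.1, q.2.1, q.2.2.2)‖ₑ ^ 2 := by
  rw [show (volume : Measure (ℝ × ℝ × ℝ × ℝ)) = volume.prod volume from rfl,
    lintegral_prod _ (by fun_prop)]
  refine lintegral_congr fun t => ?_
  rw [show (volume : Measure (ℝ × ℝ × ℝ)) = volume.prod volume from rfl,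
    lintegral_prod _ (by fun_prop)]
  refine lintegral_congr fun s => ?_
  exact (lintegral_prod_mul (μ := volume) (ν := volume)
    (f := fun z => ‖u (t, s, z)‖ₑ ^ 2) (g := fun z => ‖v (t, s, z)‖ₑ ^ 2)
    (by fun_prop) (by fun_prop)).symm

lemma mul_mixedSq_le {u v : ℝ × ℝ × ℝ → ℂ} (hu : ContDiff ℝ ∞ u)
    (hv : ContDiff ℝ ∞ v) {κ ρ : ℝ} (hκ : κ ≤ ρ)
    (bu : ∀ t z, IsBand (fun ξ => |ξ| ≤ κ) fun s => u (t, s, z))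
    (bv : ∀ t z, IsBand (fun ξ => ρ ≤ |ξ|) fun s => v (t, s, z)) :
    ENNReal.ofReal ((2 * Real.pi * (ρ - κ)) ^ 2) * mixedSq u v ≤
      ∫⁻ q, ‖pairDeriv u v q‖ₑ ^ 2 := by
  have cu := hu.continuous
  have cv := hv.continuous
  have cP := continuous_pairDeriv hu hv
  rw [mixedSq_eq cu cv, ← lintegral_const_mul' _ _ ofReal_ne_top,
    lintegral_rotate (by fun_prop), lintegral_rotate (by fun_prop)]
  refine lintegral_mono fun t => lintegral_mono fun z => lintegral_mono fun z' => ?_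
  rw [lintegral_const_mul' _ _ ofReal_ne_top]
  exact le_lintegral_pairDeriv_slice hu hv hκ (bu t z) (bv t z')

lemma rpow_half_le_of_sq {A X Y c : ℝ≥0∞} (h : A ≤ c ^ 2 * X ^ 2 * Y ^ 2) :
    A ^ (1 / 2 : ℝ) ≤ c * X * Y := by
  rw [one_div, ENNReal.rpow_inv_le_iff (by norm_num)]
  refine h.trans_eq ?_
  rw [← mul_pow, ← mul_pow]
  norm_cast

/-- The bilinear estimate with the first variable distinguished. -/
lemma exists_mixedSq_le : ∃ C : ℝ≥0, 0 < C ∧ ∀ {a : ℝ} {k₁ k₂ : ℤ} {P Q : ℝ × ℝ → Prop}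
    {u v : ℝ × ℝ × ℝ → ℂ}, |a| = 1 → k₁ + 80 ≤ k₂ → SpaceBand P u → SpaceBand Q v →
    (∀ ξ, P ξ → elen ξ ≤ 2 ^ (k₁ + 1)) →
    (∀ ξ, Q ξ → (2 ^ (k₂ - 1) ≤ elen ξ ∧ elen ξ ≤ 2 ^ (k₂ + 1)) ∧ elen ξ ≤ 4 * |ξ.1|) →
    ∀ y, mixedSq (translateSpace y u) v ^ (1 / 2 : ℝ) ≤
      (C : ℝ≥0∞) * (2 : ℝ≥0∞) ^ (-(k₂ : ℝ) / 2) * energyBound a u * energyBound a v := by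
  obtain ⟨K, hK, main⟩ := exists_lintegral_pairDeriv_le
  refine ⟨NNReal.sqrt (128 * K.toNNReal), by positivity, ?_⟩
  intro a k₁ k₂ P Q u v ha hk hu hv hP hQ y
  set c : ℝ≥0∞ := (NNReal.sqrt (128 * K.toNNReal) : ℝ≥0∞) * (2 : ℝ≥0∞) ^ (-(k₂ : ℝ) / 2) with hc
  have c2 : c ^ 2 = ENNReal.ofReal (128 * K * (2 ^ k₂)⁻¹) := by
    rw [hc, mul_pow, ← ENNReal.coe_pow, NNReal.sq_sqrt, ← ENNReal.rpow_natCast,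
      ← ENNReal.rpow_mul, show -(k₂ : ℝ) / 2 * (2 : ℕ) = -k₂ by push_cast; ring,
      show (2 : ℝ≥0∞) = ENNReal.ofReal 2 by simp, ENNReal.ofReal_rpow_of_pos two_pos,
      Real.rpow_neg two_pos.le, Real.rpow_intCast, ENNReal.ofReal_mul (by positivity),
      ENNReal.ofReal_mul (by positivity), ENNReal.coe_mul]
    simp [ENNReal.ofReal]
  have c0 : c ≠ 0 := by
    intro h
    rw [h, zero_pow two_ne_zero, eq_comm, ENNReal.ofReal_eq_zero] at c2
    exact absurd c2 (not_le.2 (by positivity))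
  have hu' : Continuous (translateSpace y u) := by
    have := hu.smooth.continuous
    unfold translateSpace; fun_prop
  by_cases hu0 : energyBound a u = 0
  · have := eq_zero_of_LinfL2_eq_zero hu.smooth.continuous (add_eq_zero.1 hu0).1
    simp [this, mixedSq, translateSpace]
  by_cases hv0 : energyBound a v = 0
  · have := eq_zero_of_LinfL2_eq_zero hv.smooth.continuous (add_eq_zero.1 hv0).1
    simp [this, mixedSq]
  by_cases huT : energyBound a u = ⊤
  · simp [huT, ENNReal.mul_top c0, ENNReal.top_mul hv0]
  by_cases hvT : energyBound a v = ⊤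
  · rw [hvT, ENNReal.mul_top (mul_ne_zero c0 hu0)]
    exact le_top
  have abs_le : ∀ ξ : ℝ × ℝ, |ξ.1| ≤ elen ξ ∧ |ξ.2| ≤ elen ξ := fun ξ =>
    ⟨Real.abs_le_sqrt (by nlinarith [sq_nonneg ξ.2]),
      Real.abs_le_sqrt (by nlinarith [sq_nonneg ξ.1])⟩
  have hk2 : (2 : ℝ) ^ (k₁ + 1) ≤ 2 ^ (k₂ - 4) := zpow_le_zpow_right₀ (by norm_num) (by omega)
  have e4 : ∀ j : ℤ, (2 : ℝ) ^ (k₂ - 4 + j) = 2 ^ (k₂ - 4) * 2 ^ j := fun j =>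
    zpow_add₀ (by norm_num) _ _
  set r : ℝ := 2 ^ (k₂ - 4) with hr
  have r0 : 0 < r := by positivity
  have e3 : (2 : ℝ) ^ (k₂ - 1) = r * 8 := by rw [show k₂ - 1 = k₂ - 4 + 3 by ring, e4]; norm_num
  have e5 : (2 : ℝ) ^ (k₂ + 1) = r * 32 := by rw [show k₂ + 1 = k₂ - 4 + 5 by ring, e4]; norm_num
  have wu := (hu.waveBounds (a := a) (κ := 2 ^ (k₂ + 1)) (fun ξ hξ => by
    have := abs_le ξ
    have := hP ξ hξ
    constructor <;> linarith) huT).translateSpace y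
  have wv := hv.waveBounds (a := a) (κ := 2 ^ (k₂ + 1)) (fun ξ hξ => by
    have := abs_le ξ
    have := (hQ ξ hξ).1.2
    constructor <;> linarith) hvT
  have upper := main ha (by positivity) toReal_nonneg toReal_nonneg wu wv
  have lower := mul_mixedSq_le (κ := r) (ρ := 2 * r) wu.smooth hv.smooth (by linarith)
    (fun t z => IsBand.comp_sub ((hu.slice_one t (z - y.2)).mono fun ξ ⟨η, hη⟩ =>
      ((abs_le _).1.trans (hP _ hη)).trans hk2) y.1)
    (fun t z => (hv.slice_one t z).mono fun ξ ⟨η, hη⟩ => by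
      have h1 := (hQ _ hη).1.1
      have h2 := (hQ _ hη).2
      simp only at h2
      linarith)
  refine rpow_half_le_of_sq ?_
  have e6 : (2 : ℝ) ^ k₂ = r * 16 := by rw [show k₂ = k₂ - 4 + 4 by ring, e4]; norm_num
  set X := (energyBound a u ^ 2).toReal with hX
  set Y := (energyBound a v ^ 2).toReal with hY
  have X0 : 0 ≤ X := toReal_nonneg
  have Y0 : 0 ≤ Y := toReal_nonneg
  have hb : 0 < (2 * Real.pi * (2 * r - r)) ^ 2 := by
    rw [show 2 * r - r = r by ring]; positivity
  have hM := lower.trans upper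
  rw [mul_comm, ← ENNReal.le_div_iff_mul_le (.inl (ENNReal.ofReal_pos.2 hb).ne')
    (.inl ofReal_ne_top),
    ← ENNReal.ofReal_div_of_pos hb] at hM
  refine hM.trans ?_
  rw [c2, ← ofReal_toReal (a := energyBound a u ^ 2) (by finiteness),
    ← ofReal_toReal (a := energyBound a v ^ 2) (by finiteness), ← hX, ← hY,
    ← ENNReal.ofReal_mul (by positivity), ← ENNReal.ofReal_mul (by positivity)]
  refine ENNReal.ofReal_le_ofReal ?_
  rw [div_le_iff₀ hb, e5, e6, show 128 * K * (r * 16)⁻¹ * X * Y * (2 * Real.pi * (2 * r - r)) ^ 2 =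
    K * (r * 32) * X * Y * Real.pi ^ 2 by field_simp; ring]
  exact le_mul_of_one_le_right (by positivity) (one_le_pow₀ (by linarith [Real.pi_gt_three]))

end

/-- Frequency-localized bilinear estimate for the hyperbolic Schrödinger equation
(Proposition on `B_m`): for `k₂ ≥ k₁ + 80` and frequency-localized `u, v` (with `v`
additionally localized to `|ξ| ≲ |ξ_m|`),
`sup_y B_m(u^y, v) ≤ C 2^{−k₂/2} (‖u‖_{L^∞L²} + I(u,N)^{1/2})(‖v‖_{L^∞L²} + I(v,N')^{1/2})`. -/
theorem bilinear_estimate_mixed_norm :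
    ∃ C : NNReal, 0 < C ∧
      ∀ k₁ k₂ : ℤ, k₁ + 80 ≤ k₂ → ∀ m : Fin 2, ∀ u v : ℝ × ℝ × ℝ → ℂ,
        ContDiff ℝ (⊤ : ℕ∞) u → ContDiff ℝ (⊤ : ℕ∞) v →
        (∀ t : ℝ, ∃ g : SchwartzMap (ℝ × ℝ) ℂ, ∀ x : ℝ × ℝ, g x = u (t, x.1, x.2)) →
        (∀ t : ℝ, ∃ g : SchwartzMap (ℝ × ℝ) ℂ, ∀ x : ℝ × ℝ, g x = v (t, x.1, x.2)) →
        (∀ (t : ℝ) (ξ : ℝ × ℝ), spatialFourier (fun x => u (t, x.1, x.2)) ξ ≠ 0 →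
          (2 : ℝ) ^ (k₁ - 1) ≤ elen ξ ∧ elen ξ ≤ (2 : ℝ) ^ (k₁ + 1)) →
        (∀ (t : ℝ) (ξ : ℝ × ℝ), spatialFourier (fun x => v (t, x.1, x.2)) ξ ≠ 0 →
          ((2 : ℝ) ^ (k₂ - 1) ≤ elen ξ ∧ elen ξ ≤ (2 : ℝ) ^ (k₂ + 1)) ∧
            elen ξ ≤ 4 * |if m = 0 then ξ.1 else ξ.2|) →
        ∀ y : ℝ × ℝ,
          Bnorm m (fun p => u (p.1, p.2.1 - y.1, p.2.2 - y.2)) v ≤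
            (C : ℝ≥0∞) * (2 : ℝ≥0∞) ^ (-(k₂ : ℝ) / 2) *
              (LinfL2 u + interact u (hypSchrod u) ^ (1 / 2 : ℝ)) *
              (LinfL2 v + interact v (hypSchrod v) ^ (1 / 2 : ℝ)) := by
  obtain ⟨C, hC, main⟩ := exists_mixedSq_le
  refine ⟨C, hC, fun k₁ k₂ hk m u v hu hv su sv fu fv y => ?_⟩
  have bu : SpaceBand _ u := ⟨hu, su, fu⟩
  have bv : SpaceBand _ v := ⟨hv, sv, fv⟩
  have elen_swap : ∀ ξ : ℝ × ℝ, elen (ξ.2, ξ.1) = elen ξ := fun ξ => by simp [elen, add_comm]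
  by_cases hm : m = 0
  · have h := main (a := 1) (by simp) hk bu bv (fun ξ h => h.2)
      (fun ξ h => by simpa only [hm, if_true] using h) y
    simp only [energyBound, ← hypSchrod_eq_waveOp] at h
    simp only [Bnorm, if_pos hm]
    exact h
  · have h := main (a := -1) (by simp) hk bu.swapSpace bv.swapSpace
      (fun ξ h => by simpa only [elen_swap] using h.2)
      (fun ξ h => by simpa only [hm, if_false, elen_swap] using h) (y.2, y.1)
    simp only [energyBound, LinfL2_swapSpace, waveOp_swapSpace _ hu, waveOp_swapSpace _ hv,
      interact_swapSpace, neg_neg, ← hypSchrod_eq_waveOp] at h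
    simp only [Bnorm, if_neg hm]
    exact h

end
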